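/- arXiv:0808.4156 — 2 statements merged into one kernel-verified Lean document; each statement's English description precedes it below -/
import Mathlib

section
/- Let μ be a stationary ergodic source with finite alphabet A and coordinate process (X_0, X_1, …), and fix k ≥ 0. Then the conditional empirical entropy of the first n coordinates converges almost surely to the k-th order conditional entropy of the source: H_k((X_0, …, X_{n−1})) → H(X_k | X_0, …, X_{k−1}) as n → ∞, μ-almost surely, where H(X_k | X_0,…,X_{k−1}) is the conditional Shannon entropy (base-2 logarithms). -/
open Filter MeasureTheory

/-- The `(k+1)`-th order empirical count `m_{a,b}(y)`: the fraction of positions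
`i` of `y` (indices extended cyclically) whose preceding `k`-context is `b` and
whose symbol is `a`. -/
noncomputable def empCount {A : Type*} [Fintype A] [DecidableEq A] (n k : ℕ)
    (y : Fin n → A) (a : A) (b : Fin k → A) : ℝ :=
  ((Finset.univ.filter fun i : Fin n =>
      y i = a ∧ ∀ j : Fin k,
        y ⟨(i.val + (n - (k - j.val) % n)) % n, Nat.mod_lt _ i.pos⟩ = b j).card : ℝ) / n

/-- The conditional empirical entropy `H_k(y)` of order `k` (base-2 logarithms,
with the convention `0·log 0 = 0`): the conditional Shannon entropy
`H(Y_{k+1} | Y_1,…,Y_k)` of a random vector distributed according to the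
empirical counts of `y`. -/
noncomputable def condEmpEntropy {A : Type*} [Fintype A] [DecidableEq A]
    (n k : ℕ) (y : Fin n → A) : ℝ :=
  -∑ b : Fin k → A, ∑ a : A,
      empCount n k y a b *
        Real.logb 2 (empCount n k y a b / ∑ a' : A, empCount n k y a' b)


section ErgodicHelpers

/-- Maximal partial sums of `g` along `T`, defined recursively. -/
noncomputable def maxPartial {α : Type*} (T : α → α) (g : α → ℝ) : ℕ → α → ℝ
  | 0, _ => 0
  | n + 1, x => max 0 (g x + maxPartial T g n (T x))

variable {α : Type*} {T : α → α} {g : α → ℝ}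

lemma maxPartial_nonneg (n : ℕ) (x : α) : 0 ≤ maxPartial T g n x := by
  cases n with
  | zero => simp [maxPartial]
  | succ n => simp [maxPartial]

lemma maxPartial_le_succ (n : ℕ) : ∀ x : α, maxPartial T g n x ≤ maxPartial T g (n + 1) x := by
  induction n with
  | zero => intro x; simp [maxPartial]
  | succ n ih =>
    intro x
    rw [maxPartial, maxPartial]
    exact max_le_max le_rfl (by linarith [ih (T x)])

lemma maxPartial_mono (x : α) : Monotone fun n => maxPartial T g n x :=
  monotone_nat_of_le_succ fun n => maxPartial_le_succ n x

lemma birkhoffSum_le_maxPartial (n : ℕ) : ∀ x : α, birkhoffSum T g n x ≤ maxPartial T g n x := by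
  induction n with
  | zero => intro x; simp [maxPartial]
  | succ n ih =>
    intro x
    rw [birkhoffSum_succ', maxPartial]
    exact le_max_of_le_right (by linarith [ih (T x)])

lemma maxPartial_le (C : ℝ) (hC : ∀ x, |g x| ≤ C) (n : ℕ) :
    ∀ x : α, maxPartial T g n x ≤ n * C := by
  induction n with
  | zero => intro x; simp [maxPartial]
  | succ n ih =>
    intro x
    have h0 : 0 ≤ C := (abs_nonneg _).trans (hC x)
    rw [maxPartial]
    push_cast
    refine max_le (by positivity) ?_
    linarith [ih (T x), (abs_le.1 (hC x)).2]

lemma maxPartial_measurable [MeasurableSpace α] (hT : Measurable T) (hg : Measurable g) (n : ℕ) :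
    Measurable (maxPartial T g n) := by
  induction n with
  | zero => exact measurable_const
  | succ n ih => exact measurable_const.max (hg.add (ih.comp hT))

lemma birkhoff_bddAbove [MeasurableSpace α] {μ : Measure α} [IsProbabilityMeasure μ]
    (hT : Ergodic T μ) (hg : Measurable g) (C : ℝ) (hC : ∀ x, |g x| ≤ C)
    (hneg : ∫ x, g x ∂μ < 0) :
    ∀ᵐ x ∂μ, ∃ K : ℝ, ∀ n, birkhoffSum T g n x ≤ K := by
  have hTm := hT.measurable
  have hM := maxPartial_measurable (T := T) hTm hg
  set B : Set α := {x | ∀ N : ℕ, ∃ n, (N : ℝ) < maxPartial T g n x} with hB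
  have hBm : MeasurableSet B := by
    have : B = ⋂ N : ℕ, ⋃ n, {x | (N : ℝ) < maxPartial T g n x} := by
      ext x; simp [hB]
    rw [this]
    exact MeasurableSet.iInter fun N => MeasurableSet.iUnion fun n =>
      measurableSet_lt measurable_const (hM n)
  have hinv : T ⁻¹' B = B := by
    ext x
    simp only [hB, Set.mem_preimage, Set.mem_ofPred_eq]
    obtain ⟨h1, h2⟩ := abs_le.1 (hC x)
    constructor
    · intro h N
      obtain ⟨R, hR⟩ := exists_nat_gt (N + C)
      obtain ⟨n, hn⟩ := h R
      refine ⟨n + 1, ?_⟩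
      rw [maxPartial]
      exact lt_max_of_lt_right (by linarith)
    · intro h N
      obtain ⟨R, hR⟩ := exists_nat_gt (N + C)
      obtain ⟨n, hn⟩ := h R
      refine ⟨n, ?_⟩
      have := hn.trans_le (maxPartial_le_succ n x)
      rw [maxPartial, lt_max_iff] at this
      rcases this with h' | h'
      · exact absurd h' (not_lt.2 (Nat.cast_nonneg _))
      · linarith
  have hint : ∀ n, Integrable (maxPartial T g n) μ := fun n =>
    Integrable.of_bound (hM n).aestronglyMeasurable (n * C) <| ae_of_all _ fun x => by
      rw [Real.norm_eq_abs, abs_of_nonneg (maxPartial_nonneg n x)]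
      exact maxPartial_le C hC n x
  have hgi : Integrable g μ := Integrable.of_bound hg.aestronglyMeasurable C <|
    ae_of_all _ hC
  rcases hT.toPreErgodic.ae_empty_or_univ hBm hinv with h | h
  · have hn : ∀ᵐ x ∂μ, x ∉ B := by
      filter_upwards [h] with x hx hxB
      have : (x ∈ B) = (x ∈ (∅ : Set α)) := hx
      rw [this] at hxB
      exact hxB
    filter_upwards [hn] with x hx
    simp only [hB, Set.mem_ofPred_eq, not_forall, not_exists, not_lt] at hx
    obtain ⟨N, hN⟩ := hx
    exact ⟨N, fun n => (birkhoffSum_le_maxPartial n x).trans (hN n)⟩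
  · exfalso
    have hx : ∀ᵐ x ∂μ, x ∈ B := by
      filter_upwards [h] with x hx
      have : (x ∈ B) = (x ∈ (Set.univ : Set α)) := hx
      rw [this]; trivial
    have hlim : Tendsto (fun n => ∫ x, (maxPartial T g (n + 1) x - maxPartial T g n (T x)) ∂μ)
        atTop (nhds (∫ x, g x ∂μ)) := by
      refine tendsto_integral_of_dominated_convergence (fun _ => C)
        (fun n => ((hM (n + 1)).sub ((hM n).comp hTm)).aestronglyMeasurable)
        (integrable_const C) ?_ ?_
      · intro n
        refine ae_of_all _ fun x => ?_
        obtain ⟨h1, h2⟩ := abs_le.1 (hC x)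
        have := maxPartial_nonneg (T := T) (g := g) n (T x)
        rw [Real.norm_eq_abs, maxPartial, abs_le]
        rcases max_cases 0 (g x + maxPartial T g n (T x)) with h | h <;>
          constructor <;> linarith [h.1, h.2, abs_nonneg (g x), hC x]
      · filter_upwards [hx] with x hx
        rw [← hinv] at hx
        refine tendsto_const_nhds.congr' ?_
        obtain ⟨R, hR⟩ := exists_nat_gt C
        obtain ⟨n0, hn0⟩ := hx R
        filter_upwards [eventually_ge_atTop n0] with n hn
        have h3 : maxPartial T g n0 (T x) ≤ maxPartial T g n (T x) := maxPartial_mono (T x) hn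
        have h4 := (abs_le.1 (hC x)).1
        rw [maxPartial, max_eq_right (by linarith)]
        ring
    have hnn : ∀ n, 0 ≤ ∫ x, (maxPartial T g (n + 1) x - maxPartial T g n (T x)) ∂μ := by
      intro n
      have hcomp : Integrable (fun x => maxPartial T g n (T x)) μ :=
        hT.toMeasurePreserving.integrable_comp_of_integrable (hint n)
      have hmap : ∫ x, maxPartial T g n (T x) ∂μ = ∫ x, maxPartial T g n x ∂μ := by
        conv_rhs => rw [← hT.toMeasurePreserving.map_eq]
        exact (integral_map hTm.aemeasurable (hM n).aestronglyMeasurable).symm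
      rw [integral_sub (hint _) hcomp, hmap, sub_nonneg]
      exact integral_mono (hint n) (hint (n + 1)) (maxPartial_le_succ n)
    exact absurd (ge_of_tendsto' hlim hnn) (not_le.2 hneg)

lemma birkhoff_upper [MeasurableSpace α] {μ : Measure α} [IsProbabilityMeasure μ]
    (hT : Ergodic T μ) (hg : Measurable g) (C : ℝ) (hC : ∀ x, |g x| ≤ C) :
    ∀ᵐ x ∂μ, ∀ c : ℝ, ∫ x, g x ∂μ < c →
      ∀ᶠ n : ℕ in atTop, birkhoffSum T g n x / n < c := by
  have hgi : Integrable g μ := Integrable.of_bound hg.aestronglyMeasurable C <|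
    ae_of_all _ hC
  have key : ∀ q : ℚ, ∫ x, g x ∂μ < q → ∀ᵐ x ∂μ, ∃ K : ℝ, ∀ n,
      birkhoffSum T (fun x => g x - q) n x ≤ K := by
    intro q hq
    refine birkhoff_bddAbove hT (hg.sub_const _) (C + |(q : ℝ)|) (fun x => ?_) ?_
    · exact (abs_sub _ _).trans (by linarith [hC x])
    · rw [integral_sub hgi (integrable_const _)]
      simpa using hq
  have key2 : ∀ᵐ x ∂μ, ∀ q : ℚ, ∫ x, g x ∂μ < q → ∃ K : ℝ, ∀ n,
      birkhoffSum T (fun x => g x - q) n x ≤ K := by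
    rw [ae_all_iff]
    intro q
    by_cases hq : ∫ x, g x ∂μ < q
    · filter_upwards [key q hq] with x hx _ using hx
    · exact ae_of_all _ fun x h => absurd h hq
  filter_upwards [key2] with x hx c hc
  obtain ⟨q, hq1, hq2⟩ := exists_rat_btwn hc
  obtain ⟨K, hK⟩ := hx q hq1
  have ht : Tendsto (fun n : ℕ => K / (n : ℝ)) atTop (nhds 0) :=
    tendsto_const_div_atTop_nhds_zero_nat K
  filter_upwards [ht.eventually (gt_mem_nhds (sub_pos.2 hq2)), eventually_gt_atTop 0]
    with n hn hn0
  have hn0' : (0 : ℝ) < n := by exact_mod_cast hn0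
  have h := hK n
  simp only [birkhoffSum, Finset.sum_sub_distrib, Finset.sum_const, Finset.card_range,
    nsmul_eq_mul] at h
  rw [div_lt_iff₀ hn0'] at hn ⊢
  simp only [birkhoffSum]
  nlinarith

lemma birkhoff_tendsto [MeasurableSpace α] {μ : Measure α} [IsProbabilityMeasure μ]
    (hT : Ergodic T μ) (hg : Measurable g) (C : ℝ) (hC : ∀ x, |g x| ≤ C) :
    ∀ᵐ x ∂μ, Tendsto (fun n : ℕ => birkhoffSum T g n x / n) atTop (nhds (∫ x, g x ∂μ)) := by
  filter_upwards [birkhoff_upper hT hg C hC,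
    birkhoff_upper hT hg.neg C (fun x => by simpa using hC x)] with x h1 h2
  refine tendsto_order.2 ⟨fun c hc => ?_, fun c hc => h1 c hc⟩
  have := h2 (-c) (by simp only [Pi.neg_apply, integral_neg]; linarith)
  filter_upwards [this] with n hn
  have e : birkhoffSum T (-g) n x = - birkhoffSum T g n x := by
    simp [birkhoffSum]
  rw [e, neg_div] at hn
  linarith

end ErgodicHelpers

section CountHelpers

variable {A : Type*} [Fintype A] [DecidableEq A]

lemma shift_iterate (x : ℕ → A) (l : ℕ) :
    (fun x : ℕ → A => fun i => x (i + 1))^[l] x = fun i => x (i + l) := by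
  induction l with
  | zero => rfl
  | succ l ih =>
    rw [Function.iterate_succ_apply', ih]
    funext i
    show x (i + 1 + l) = x (i + (l + 1))
    congr 1; omega

/-- Indicator of the cylinder `(b, a)`. -/
noncomputable def cylInd (k : ℕ) (a : A) (b : Fin k → A) (x : ℕ → A) : ℝ :=
  if x k = a ∧ ∀ j : Fin k, x j = b j then 1 else 0

lemma empCount_close (k n : ℕ) (hn : k < n) (a : A) (b : Fin k → A) (x : ℕ → A) :
    |empCount n k (fun i : Fin n => x i.val) a b -
      birkhoffSum (fun x : ℕ → A => fun i => x (i + 1)) (cylInd k a b) n x / n| ≤ k / n := by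
  obtain ⟨m, rfl⟩ : ∃ m, n = k + m := ⟨n - k, by omega⟩
  have hn0 : (0 : ℝ) < ((k + m : ℕ) : ℝ) := by exact_mod_cast (by omega : 0 < k + m)
  set Q : ℕ → ℝ := fun i => if x i = a ∧ ∀ j : Fin k,
    x ((i + ((k + m) - (k - j.val) % (k + m))) % (k + m)) = b j then 1 else 0 with hQ
  set P : ℕ → ℝ := fun l => if x (k + l) = a ∧ ∀ j : Fin k, x (j + l) = b j then 1 else 0 with hP
  have h1 : empCount (k + m) k (fun i : Fin (k + m) => x i.val) a b =
      (∑ i ∈ Finset.range (k + m), Q i) / (k + m : ℕ) := by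
    rw [empCount, ← Fin.sum_univ_eq_sum_range, Finset.card_filter]
    push_cast
    rfl
  have h2 : birkhoffSum (fun x : ℕ → A => fun i => x (i + 1)) (cylInd k a b) (k + m) x =
      ∑ l ∈ Finset.range (k + m), P l := by
    simp only [birkhoffSum, shift_iterate, cylInd, hP]
  have hQP : ∀ l ∈ Finset.range m, Q (k + l) = P l := by
    intro l hl
    rw [Finset.mem_range] at hl
    simp only [hQ, hP]
    have : ∀ j : Fin k, (k + l + ((k + m) - (k - j.val) % (k + m))) % (k + m) = j + l := by
      intro j
      have hj := j.2
      rw [Nat.mod_eq_of_lt (by omega : k - j.val < k + m),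
        show k + l + (k + m - (k - j.val)) = (j + l) + (k + m) by omega, Nat.add_mod_right,
        Nat.mod_eq_of_lt (by omega)]
    simp only [this]
  have hQ01 : ∀ i, 0 ≤ Q i ∧ Q i ≤ 1 := by
    intro i; simp only [hQ]; split_ifs <;> norm_num
  have hP01 : ∀ i, 0 ≤ P i ∧ P i ≤ 1 := by
    intro i; simp only [hP]; split_ifs <;> norm_num
  have e1 : ∑ i ∈ Finset.range (k + m), Q i =
      ∑ i ∈ Finset.range k, Q i + ∑ l ∈ Finset.range m, P l := by
    rw [Finset.sum_range_add, Finset.sum_congr rfl hQP]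
  have e2 : ∑ l ∈ Finset.range (k + m), P l =
      ∑ l ∈ Finset.range m, P l + ∑ l ∈ Finset.range k, P (m + l) := by
    rw [add_comm k m, Finset.sum_range_add]
  have b1 : ∑ i ∈ Finset.range k, Q i ≤ k := by
    simpa using Finset.sum_le_sum (s := Finset.range k) fun i _ => (hQ01 i).2
  have b2 : ∑ i ∈ Finset.range k, P (m + i) ≤ k := by
    simpa using Finset.sum_le_sum (s := Finset.range k) fun i _ => (hP01 (m + i)).2
  have b3 : 0 ≤ ∑ i ∈ Finset.range k, Q i := Finset.sum_nonneg fun i _ => (hQ01 i).1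
  have b4 : 0 ≤ ∑ i ∈ Finset.range k, P (m + i) := Finset.sum_nonneg fun i _ => (hP01 _).1
  rw [h1, h2, ← sub_div, abs_div, abs_of_pos hn0, e1, e2]
  refine div_le_div_of_nonneg_right ?_ hn0.le
  rw [abs_le]
  constructor <;> linarith

lemma empCount_tendsto [MeasurableSpace A] [DiscreteMeasurableSpace A]
    (μ : Measure (ℕ → A)) [IsProbabilityMeasure μ]
    (herg : Ergodic (fun x : ℕ → A => fun i => x (i + 1)) μ) (k : ℕ) (a : A) (b : Fin k → A) :
    ∀ᵐ x ∂μ, Tendsto (fun n : ℕ => empCount n k (fun i : Fin n => x i.val) a b) atTop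
      (nhds (μ {x : ℕ → A | x k = a ∧ ∀ j : Fin k, x j = b j}).toReal) := by
  have hms : MeasurableSet {x : ℕ → A | x k = a ∧ ∀ j : Fin k, x j = b j} := by
    have e : {x : ℕ → A | x k = a ∧ ∀ j : Fin k, x j = b j} =
        ((fun x : ℕ → A => x k) ⁻¹' {a}) ∩ ⋂ j : Fin k, (fun x : ℕ → A => x j) ⁻¹' {b j} := by
      ext x; simp
    rw [e]
    exact (measurable_pi_apply k (MeasurableSet.of_discrete)).inter
      (MeasurableSet.iInter fun j => measurable_pi_apply _ (MeasurableSet.of_discrete))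
  have hind : cylInd k a b =
      Set.indicator {x : ℕ → A | x k = a ∧ ∀ j : Fin k, x j = b j} (fun _ => (1 : ℝ)) := by
    funext x
    simp [cylInd, Set.indicator_apply]
  have hmeas : Measurable (cylInd k a b) := by
    rw [hind]; exact measurable_const.indicator hms
  have hI : ∫ x, cylInd k a b x ∂μ =
      (μ {x : ℕ → A | x k = a ∧ ∀ j : Fin k, x j = b j}).toReal := by
    rw [hind, integral_indicator hms]
    simp [Measure.real]
  rw [← hI]
  filter_upwards [birkhoff_tendsto herg hmeas 1
    (fun x => by simp only [cylInd]; split_ifs <;> norm_num)] with x hx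
  have hd : Tendsto (fun n : ℕ => empCount n k (fun i : Fin n => x i.val) a b -
      birkhoffSum (fun x : ℕ → A => fun i => x (i + 1)) (cylInd k a b) n x / n) atTop
      (nhds 0) := by
    refine squeeze_zero_norm' ?_ (tendsto_const_div_atTop_nhds_zero_nat (k : ℝ))
    filter_upwards [eventually_gt_atTop k] with n hn
    exact empCount_close k n hn a b x
  simpa using hd.add hx

lemma condEnt_split {ι : Type*} [Fintype ι] (p : ι → ℝ) (hp : ∀ a, 0 ≤ p a) :
    ∑ a, p a * Real.logb 2 (p a / ∑ a', p a') =
      (Real.negMulLog (∑ a, p a) - ∑ a, Real.negMulLog (p a)) / Real.log 2 := by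
  have h : ∀ a, p a * Real.logb 2 (p a / ∑ a', p a') =
      (p a * (-Real.log (∑ a', p a')) - Real.negMulLog (p a)) / Real.log 2 := by
    intro a
    rcases (hp a).eq_or_lt with h0 | h0
    · simp [← h0]
    · have hs : 0 < ∑ a', p a' :=
        h0.trans_le (Finset.single_le_sum (fun i _ => hp i) (Finset.mem_univ a))
      rw [Real.logb, Real.log_div h0.ne' hs.ne', Real.negMulLog]
      ring
  rw [Finset.sum_congr rfl fun a _ => h a, ← Finset.sum_div, Finset.sum_sub_distrib,
    ← Finset.sum_mul]
  simp only [Real.negMulLog]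
  ring

lemma empCount_nonneg (n k : ℕ) (y : Fin n → A) (a : A) (b : Fin k → A) :
    0 ≤ empCount n k y a b := by
  unfold empCount; positivity

end CountHelpers

/-- Almost sure convergence of the conditional empirical entropy: for a
stationary ergodic source with finite alphabet `A` and any fixed `k`, the
conditional empirical entropy of the first `n` coordinates converges almost
surely to the `k`-th order conditional entropy
`H(X_k | X_0,…,X_{k−1}) = −Σ_w p(w) log₂(p(w)/q(w|_k))` of the source. -/
theorem condEmpEntropy_tendsto_condEntropy {A : Type*} [Fintype A] [DecidableEq A]
    [MeasurableSpace A] [DiscreteMeasurableSpace A]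
    (μ : Measure (ℕ → A)) [IsProbabilityMeasure μ]
    (herg : Ergodic (fun x : ℕ → A => fun i => x (i + 1)) μ) (k : ℕ) :
    ∀ᵐ x ∂μ, Tendsto
      (fun n : ℕ => condEmpEntropy n k fun i : Fin n => x i.val)
      atTop
      (nhds (-∑ w : Fin (k + 1) → A,
        (μ {x : ℕ → A | ∀ j : Fin (k + 1), x j = w j}).toReal *
          Real.logb 2 ((μ {x : ℕ → A | ∀ j : Fin (k + 1), x j = w j}).toReal /
            (μ {x : ℕ → A | ∀ j : Fin k, x j = w j.castSucc}).toReal))) := by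
  have hms : ∀ (m : ℕ) (w : Fin m → A), MeasurableSet {x : ℕ → A | ∀ j : Fin m, x j = w j} := by
    intro m w
    have e : {x : ℕ → A | ∀ j : Fin m, x j = w j} =
        ⋂ j : Fin m, (fun x : ℕ → A => x j) ⁻¹' {w j} := by
      ext x; simp
    rw [e]
    exact MeasurableSet.iInter fun j => measurable_pi_apply _ (MeasurableSet.of_discrete)
  set p : (Fin k → A) → A → ℝ := fun b a =>
    (μ {x : ℕ → A | x k = a ∧ ∀ j : Fin k, x j = b j}).toReal with hp
  have hp0 : ∀ b a, 0 ≤ p b a := fun b a => ENNReal.toReal_nonneg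
  have hsum : ∀ b : Fin k → A, (μ {x : ℕ → A | ∀ j : Fin k, x j = b j}).toReal = ∑ a, p b a := by
    intro b
    have hm : ∀ a : A, MeasurableSet {x : ℕ → A | x k = a ∧ ∀ j : Fin k, x j = b j} := by
      intro a
      have e1 : {x : ℕ → A | x k = a ∧ ∀ j : Fin k, x j = b j} =
          ((fun x : ℕ → A => x k) ⁻¹' {a}) ∩ {x : ℕ → A | ∀ j : Fin k, x j = b j} := by
        ext x; simp
      rw [e1]
      exact (measurable_pi_apply k (MeasurableSet.of_discrete)).inter (hms k b)
    have e : {x : ℕ → A | ∀ j : Fin k, x j = b j} =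
        ⋃ a : A, {x : ℕ → A | x k = a ∧ ∀ j : Fin k, x j = b j} := by
      ext x; simp
    rw [e, measure_iUnion _ hm, tsum_fintype, ENNReal.toReal_sum fun a _ => measure_ne_top _ _]
    intro a a' haa
    refine Set.disjoint_left.2 fun x hx hx' => haa (hx.1.symm.trans hx'.1)
  have htarget : ∑ w : Fin (k + 1) → A,
        (μ {x : ℕ → A | ∀ j : Fin (k + 1), x j = w j}).toReal *
          Real.logb 2 ((μ {x : ℕ → A | ∀ j : Fin (k + 1), x j = w j}).toReal /
            (μ {x : ℕ → A | ∀ j : Fin k, x j = w j.castSucc}).toReal) =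
      ∑ b : Fin k → A, ∑ a : A, p b a * Real.logb 2 (p b a / ∑ a' : A, p b a') := by
    rw [Finset.sum_comm, ← Fintype.sum_prod_type'
      (f := fun a b => p b a * Real.logb 2 (p b a / ∑ a' : A, p b a'))]
    refine (Fintype.sum_equiv (Fin.snocEquiv fun _ => A) _ _ ?_).symm
    rintro ⟨a, b⟩
    have e : {x : ℕ → A | ∀ j : Fin (k + 1), x j = (Fin.snocEquiv fun _ => A) (a, b) j} =
        {x : ℕ → A | x k = a ∧ ∀ j : Fin k, x j = b j} := by
      ext x
      simp [Fin.snocEquiv, Fin.forall_fin_succ', and_comm]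
    have e' : {x : ℕ → A | ∀ j : Fin k, x j = (Fin.snocEquiv fun _ => A) (a, b) j.castSucc} =
        {x : ℕ → A | ∀ j : Fin k, x j = b j} := by
      ext x
      simp [Fin.snocEquiv]
    rw [e, e', hsum]
  rw [htarget]
  have hall : ∀ᵐ x ∂μ, ∀ (b : Fin k → A) (a : A),
      Tendsto (fun n : ℕ => empCount n k (fun i : Fin n => x i.val) a b) atTop
        (nhds (p b a)) := by
    rw [ae_all_iff]; intro b
    rw [ae_all_iff]; intro a
    exact empCount_tendsto μ herg k a b
  filter_upwards [hall] with x hx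
  simp only [condEmpEntropy]
  refine (tendsto_finset_sum _ fun b _ => ?_).neg
  rw [condEnt_split _ (hp0 b)]
  simp only [condEnt_split _ (fun a => empCount_nonneg _ k _ a b)]
  refine Tendsto.div_const (Tendsto.sub ?_ (tendsto_finset_sum _ fun a _ => ?_)) _
  · exact (Real.continuous_negMulLog.tendsto _).comp (tendsto_finset_sum _ fun a _ => hx b a)
  · exact (Real.continuous_negMulLog.tendsto _).comp (hx b a)
end

section
/- Universality of exhaustive-search fixed-slope lossy coding: let μ be a stationary ergodic source on 𝒳^ℕ, let α > 0, and let (k_n) be a sequence of nonnegative integers with k_n → ∞ and k_n/log n → 0 (and k_n < n). Then for μ-almost every x ∈ 𝒳^ℕ, lim_{n→∞} min_{y ∈ 𝒳̂ⁿ} [ H_{k_n}(y) + α d_n((x_0,…,x_{n−1}), y) ] = inf_{D ≥ 0} [ R(D) + αD ]. -/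
open Filter MeasureTheory

/-- Average per-letter distortion `d_n(x,y) = (1/n) Σ_i d(x_i, y_i)`. -/
noncomputable def avgDist {X Xh : Type*} (d : X → Xh → ℝ) (n : ℕ)
    (x : Fin n → X) (y : Fin n → Xh) : ℝ :=
  (∑ i, d (x i) (y i)) / n

/-- Base-2 Shannon entropy of a pmf on a finite set (convention `0·log 0 = 0`). -/
noncomputable def shannonEntropy {Ω : Type*} [Fintype Ω] (p : Ω → ℝ) : ℝ :=
  -∑ ω, p ω * Real.logb 2 (p ω)

/-- Mutual information `I(ν) = H(ν₁) + H(ν₂) − H(ν)` of a joint pmf on a finite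
product space. -/
noncomputable def mutualInfo {Ω₁ Ω₂ : Type*} [Fintype Ω₁] [Fintype Ω₂]
    (ν : Ω₁ × Ω₂ → ℝ) : ℝ :=
  shannonEntropy (fun a => ∑ b, ν (a, b)) + shannonEntropy (fun b => ∑ a, ν (a, b)) -
    shannonEntropy ν

/-- The `n`-th order rate-distortion function `R_n(D) = (1/n)·inf I(ν)`, the
infimum over joint pmfs `ν` on `𝒳ⁿ × 𝒳̂ⁿ` with first marginal the law of the
first `n` source coordinates and expected distortion at most `D` (the infimum
over the empty set being `+∞`, whence the `EReal` value). -/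
noncomputable def RDn {X Xh : Type*} [Fintype X] [Fintype Xh] [DecidableEq X]
    [DecidableEq Xh] [MeasurableSpace X]
    (μ : MeasureTheory.Measure (ℕ → X)) (d : X → Xh → ℝ) (n : ℕ) (D : ℝ) : EReal :=
  sInf {r : EReal | ∃ ν : (Fin n → X) × (Fin n → Xh) → ℝ,
    (∀ p, 0 ≤ ν p) ∧ (∑ p, ν p = 1) ∧
    (∀ w : Fin n → X, ∑ y : Fin n → Xh, ν (w, y) =
      (μ {x : ℕ → X | ∀ i : Fin n, x i.val = w i}).toReal) ∧
    (∑ p : (Fin n → X) × (Fin n → Xh), ν p * avgDist d n p.1 p.2 ≤ D) ∧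
    r = ((mutualInfo ν / n : ℝ) : EReal)}

/-- The rate-distortion function `R(D) = inf_{n ≥ 1} R_n(D)`. -/
noncomputable def RDfun {X Xh : Type*} [Fintype X] [Fintype Xh] [DecidableEq X]
    [DecidableEq Xh] [MeasurableSpace X]
    (μ : MeasureTheory.Measure (ℕ → X)) (d : X → Xh → ℝ) (D : ℝ) : EReal :=
  ⨅ n : {m : ℕ // 1 ≤ m}, RDn (Xh := Xh) μ d n D

set_option linter.unusedSectionVars false
set_option linter.deprecated false
set_option linter.unusedVariables false

namespace EFS

/-- Gibbs inequality. -/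
theorem gibbs {ι : Type*} (s : Finset ι) (p q : ι → ℝ) (hp : ∀ i ∈ s, 0 ≤ p i)
    (hq : ∀ i ∈ s, 0 ≤ q i) (hpq : ∀ i ∈ s, 0 < p i → 0 < q i)
    (hsum : ∑ i ∈ s, q i ≤ ∑ i ∈ s, p i) :
    ∑ i ∈ s, p i * Real.logb 2 (q i) ≤ ∑ i ∈ s, p i * Real.logb 2 (p i) := by
  have hl : 0 < Real.log 2 := Real.log_pos (by norm_num)
  have key : ∀ i ∈ s, p i * Real.logb 2 (q i) - p i * Real.logb 2 (p i) ≤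
      (q i - p i) / Real.log 2 := by
    intro i hi
    rcases (hp i hi).eq_or_lt with h | h
    · rw [← h]; simp; exact div_nonneg (hq i hi) hl.le
    · have hqi := hpq i hi h
      have := Real.log_le_sub_one_of_pos (div_pos hqi h)
      rw [Real.log_div hqi.ne' h.ne'] at this
      unfold Real.logb
      rw [← mul_sub, ← sub_div, ← mul_div_assoc]
      apply div_le_div_of_nonneg_right _ hl.le
      calc _ ≤ p i * (q i / p i - 1) := by gcongr
        _ = _ := by field_simp
  have := Finset.sum_le_sum key
  rw [Finset.sum_sub_distrib, ← Finset.sum_div, Finset.sum_sub_distrib] at this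
  have h2 : (∑ i ∈ s, q i - ∑ i ∈ s, p i) / Real.log 2 ≤ 0 :=
    div_nonpos_of_nonpos_of_nonneg (by linarith) hl.le
  linarith

section lists
variable {A : Type*} [Fintype A]

/-- Sum of a function over all lists of length `n`. -/
noncomputable def sumL (n : ℕ) (f : List A → ℝ) : ℝ := ∑ y : Fin n → A, f (List.ofFn y)

theorem sumL_zero (f : List A → ℝ) : sumL 0 f = f [] := by
  simp [sumL]

theorem sumL_succ (n : ℕ) (f : List A → ℝ) :
    sumL (n + 1) f = ∑ a, sumL n (fun l => f (a :: l)) := by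
  unfold sumL
  rw [← (Fin.consEquiv (fun _ : Fin (n+1) => A)).sum_comp, Fintype.sum_prod_type]
  simp [Fin.consEquiv, List.ofFn_succ]

theorem sumL_add (m n : ℕ) (f : List A → ℝ) :
    sumL (m + n) f = sumL m (fun u => sumL n (fun w => f (u ++ w))) := by
  induction m generalizing f with
  | zero => simp [sumL_zero]
  | succ m ih =>
    rw [show m + 1 + n = (m + n) + 1 by ring, sumL_succ, sumL_succ]
    simp [ih]

theorem sumL_mono {n : ℕ} {f g : List A → ℝ} (h : ∀ l, l.length = n → f l ≤ g l) :
    sumL n f ≤ sumL n g := Finset.sum_le_sum fun y _ => h _ (by simp)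

theorem sumL_congr {n : ℕ} {f g : List A → ℝ} (h : ∀ l, l.length = n → f l = g l) :
    sumL n f = sumL n g := Finset.sum_congr rfl fun y _ => h _ (by simp)

theorem sumL_nonneg {n : ℕ} {f : List A → ℝ} (h : ∀ l, l.length = n → 0 ≤ f l) :
    0 ≤ sumL n f := Finset.sum_nonneg fun y _ => h _ (by simp)

theorem sumL_mul_left (n : ℕ) (c : ℝ) (f : List A → ℝ) :
    sumL n (fun l => c * f l) = c * sumL n f := by simp [sumL, Finset.mul_sum]

theorem sumL_mul_right (n : ℕ) (c : ℝ) (f : List A → ℝ) :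
    sumL n (fun l => f l * c) = sumL n f * c := by simp [sumL, Finset.sum_mul]

theorem sumL_sum {ι : Type*} (s : Finset ι) (n : ℕ) (f : ι → List A → ℝ) :
    sumL n (fun l => ∑ i ∈ s, f i l) = ∑ i ∈ s, sumL n (f i) := Finset.sum_comm

theorem exists_ofFn {n : ℕ} {l : List A} (h : l.length = n) : ∃ y : Fin n → A, List.ofFn y = l := by
  subst h; exact ⟨l.get, List.ofFn_get l⟩

theorem le_sumL {n : ℕ} {f : List A → ℝ} (h : ∀ l, l.length = n → 0 ≤ f l) {l : List A}
    (hl : l.length = n) : f l ≤ sumL n f := by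
  obtain ⟨y, rfl⟩ := exists_ofFn hl
  exact Finset.single_le_sum (f := fun y : Fin n → A => f (List.ofFn y))
    (fun y _ => h _ (by simp)) (Finset.mem_univ y)

/-- Renewal weights generated by `v`. -/
noncomputable def ren (v : List A → ℝ) : List A → ℝ
  | [] => 1
  | a :: l => ∑ m ∈ Finset.range (l.length + 1), v (a :: l.take m) * ren v (l.drop m)
  termination_by l => l.length
  decreasing_by simp

variable {v : List A → ℝ}

theorem ren_nil : ren v ([] : List A) = 1 := by rw [ren]

theorem ren_cons (a : A) (l : List A) : ren v (a :: l) =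
    ∑ m ∈ Finset.range (l.length + 1), v (a :: l.take m) * ren v (l.drop m) := by rw [ren]

theorem ren_nonneg (hv : ∀ l, 0 ≤ v l) : ∀ (n : ℕ) (l : List A), l.length = n → 0 ≤ ren v l := by
  intro n
  induction n using Nat.strong_induction_on with
  | _ n ih =>
    intro l hl
    cases l with
    | nil => rw [ren_nil]; norm_num
    | cons a l =>
      rw [ren_cons]
      refine Finset.sum_nonneg fun m _ => mul_nonneg (hv _) (ih _ ?_ _ rfl)
      simp at hl ⊢; omega

theorem ren_nonneg' (hv : ∀ l, 0 ≤ v l) (l : List A) : 0 ≤ ren v l := ren_nonneg hv _ l rfl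

theorem ren_append (hv : ∀ l, 0 ≤ v l) (w : List A) :
    ∀ (n : ℕ) (u : List A), u.length = n → ren v u * ren v w ≤ ren v (u ++ w) := by
  intro n
  induction n using Nat.strong_induction_on with
  | _ n ih =>
    intro u hu
    cases u with
    | nil => simp [ren_nil]
    | cons a l =>
      rw [List.cons_append, ren_cons, ren_cons, Finset.sum_mul]
      calc _ ≤ ∑ m ∈ Finset.range (l.length + 1),
            v (a :: (l ++ w).take m) * ren v ((l ++ w).drop m) := by
            refine Finset.sum_le_sum fun m hm => ?_
            have hm' : m ≤ l.length := by simp at hm; omega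
            rw [List.take_append_of_le_length hm', List.drop_append_of_le_length hm', mul_assoc]
            refine mul_le_mul_of_nonneg_left (ih _ ?_ _ rfl) (hv _)
            simp at hu ⊢; omega
        _ ≤ _ := by
            refine Finset.sum_le_sum_of_subset_of_nonneg ?_ ?_
            · intro m; simp; omega
            · intro m _ _; exact mul_nonneg (hv _) (ren_nonneg' hv _)

theorem le_ren (hv : ∀ l, 0 ≤ v l) {l : List A} (hl : l ≠ []) : v l ≤ ren v l := by
  cases l with
  | nil => exact absurd rfl hl
  | cons a l =>
    rw [ren_cons]
    refine le_trans ?_ (Finset.single_le_sum (a := l.length)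
      (fun m _ => mul_nonneg (hv _) (ren_nonneg' hv _)) (by simp))
    simp [ren_nil]

theorem ren_pos (hv : ∀ l, 0 ≤ v l) (hv1 : ∀ a, 0 < v [a]) (l : List A) : 0 < ren v l := by
  induction l with
  | nil => rw [ren_nil]; norm_num
  | cons a l ih =>
    refine lt_of_lt_of_le ?_ (ren_append hv l _ [a] rfl)
    exact mul_pos ((hv1 a).trans_le (le_ren hv (by simp))) ih

theorem ren_kraft (hv : ∀ l, 0 ≤ v l) (s : ℕ → ℝ) (hs : ∀ m, sumL (m + 1) v ≤ s m)
    (hs1 : ∀ n, ∑ m ∈ Finset.range n, s m ≤ 1) (n : ℕ) : sumL n (ren v) ≤ 1 := by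
  induction n using Nat.strong_induction_on with
  | _ n ih =>
    cases n with
    | zero => simp [sumL_zero, ren_nil]
    | succ n =>
      have h1 : sumL (n + 1) (ren v) = ∑ m ∈ Finset.range (n + 1),
          sumL (n + 1) (fun l => v (l.take (m + 1)) * ren v (l.drop (m + 1))) := by
        rw [← sumL_sum]
        refine sumL_congr fun l hl => ?_
        cases l with
        | nil => simp at hl
        | cons a l => rw [ren_cons]; simp at hl; rw [hl]; simp
      rw [h1]
      refine le_trans (Finset.sum_le_sum fun m hm => ?_) (hs1 (n + 1))
      have hm' : m ≤ n := by simp at hm; omega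
      have h2 : n + 1 = (m + 1) + (n - m) := by omega
      rw [h2, sumL_add]
      have h3 : sumL (m + 1) (fun u => sumL (n - m) (fun w =>
          v ((u ++ w).take (m + 1)) * ren v ((u ++ w).drop (m + 1)))) =
          sumL (m + 1) (fun u => v u * sumL (n - m) (ren v)) := by
        refine sumL_congr fun u hu => ?_
        rw [← sumL_mul_left]
        refine sumL_congr fun w _ => ?_
        rw [← hu]; simp
      rw [h3, sumL_mul_right]
      have h4 := ih (n - m) (by omega)
      have h5 : 0 ≤ sumL (m + 1) v := sumL_nonneg fun l _ => hv l
      calc _ ≤ sumL (m + 1) v * 1 := by gcongr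
        _ ≤ _ := by rw [mul_one]; exact hs m

end lists
end EFS

namespace EFS

section kingman
variable {Ω : Type*} [MeasurableSpace Ω] {μ : Measure Ω} [IsProbabilityMeasure μ] {T : Ω → Ω}

theorem greedy_bound (T : Ω → Ω) (F : ℕ → Ω → ℝ) (C : ℝ) (h0 : 0 ≤ C)
    (hC : ∀ n x, F n x ≤ C * n)
    (hsub : ∀ n m x, F (n + m) x ≤ F n x + F m (T^[n] x))
    (c : ℝ) (hc : 0 ≤ c) (M : ℕ) (B : Set Ω)
    (hB : ∀ x, x ∉ B → ∃ n, 1 ≤ n ∧ n ≤ M ∧ F n x ≤ n * c) (n : ℕ) :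
    ∀ x, F n x ≤ n * c + C * ∑ i ∈ Finset.range n, B.indicator 1 (T^[i] x) + C * M := by
  have hind : ∀ x, 0 ≤ B.indicator (1 : Ω → ℝ) x := fun x =>
    Set.indicator_nonneg (fun _ _ => zero_le_one) x
  induction n using Nat.strong_induction_on with
  | _ n ih =>
    intro x
    have hs : ∀ k y, 0 ≤ C * ∑ i ∈ Finset.range k, B.indicator (1 : Ω → ℝ) (T^[i] y) := fun k y =>
      mul_nonneg h0 (Finset.sum_nonneg fun i _ => hind _)
    have hnc : 0 ≤ (n : ℝ) * c := by positivity
    by_cases hn : n ≤ M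
    · have h1 := hC n x
      have h2 : C * n ≤ C * M := by gcongr
      linarith [hs n x]
    · push Not at hn
      by_cases hx : x ∈ B
      · obtain ⟨k, rfl⟩ : ∃ k, n = 1 + k := ⟨n - 1, by omega⟩
        have h1 := hsub 1 k x
        have h2 := ih k (by omega) (T^[1] x)
        have h3 := hC 1 x
        rw [add_comm 1 k, Finset.sum_range_succ', add_comm k 1]
        simp only [Function.iterate_zero, id, Function.iterate_succ, Function.comp] at h1 h2 ⊢
        rw [Set.indicator_of_mem hx]
        push_cast at h1 h2 h3 ⊢
        simp only [Pi.one_apply]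
        nlinarith
      · obtain ⟨m, hm1, hmM, hm⟩ := hB x hx
        obtain ⟨k, rfl⟩ : ∃ k, n = m + k := ⟨n - m, by omega⟩
        have h1 := hsub m k x
        have h2 := ih k (by omega) (T^[m] x)
        rw [Finset.sum_range_add]
        have h3 : ∀ i, T^[i] (T^[m] x) = T^[m + i] x := fun i => by
          rw [← Function.iterate_add_apply, add_comm]
        simp only [h3] at h2
        have h4 := hs m x
        push_cast
        rw [mul_add]
        linarith

theorem kingman_lower (hT : Ergodic T μ) (F : ℕ → Ω → ℝ) (hm : ∀ n, Measurable (F n)) (C : ℝ)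
    (h0 : ∀ n x, 0 ≤ F n x) (hC : ∀ n x, F n x ≤ C * n)
    (hsub : ∀ n m x, F (n + m) x ≤ F n x + F m (T^[n] x)) (r : ℝ)
    (hr : ∀ n : ℕ, 1 ≤ n → n * r ≤ ∫ x, F n x ∂μ) (c : ℝ) (hcr : c < r) :
    ∀ᵐ x ∂μ, ∀ᶠ n : ℕ in atTop, n * c ≤ F n x := by
  by_cases hc : c < 0
  · refine Eventually.of_forall fun x => Eventually.of_forall fun n => ?_
    exact (mul_nonpos_of_nonneg_of_nonpos (by positivity) hc.le).trans (h0 n x)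
  push Not at hc
  obtain ⟨x0⟩ : Nonempty Ω := μ.nonempty_of_neZero
  have hC0 : 0 ≤ C := by have := (h0 1 x0).trans (hC 1 x0); simpa using this
  obtain ⟨c', hcc', hc'r⟩ := exists_between hcr
  set E : Set Ω := ⋃ q : ℚ, {x | (q : ℝ) < c' ∧ ∃ᶠ n : ℕ in atTop, F n x < n * q} with hE
  have hEm : MeasurableSet E := by
    refine MeasurableSet.iUnion fun q => ?_
    have : {x | (q : ℝ) < c' ∧ ∃ᶠ n : ℕ in atTop, F n x < n * q} =
        {x | (q : ℝ) < c'} ∩ ⋂ N : ℕ, ⋃ n : ℕ, ⋃ _ : N ≤ n, {x | F n x < n * q} := by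
      ext x; simp [frequently_atTop]
    rw [this]
    refine (MeasurableSet.const _).inter (MeasurableSet.iInter fun N => MeasurableSet.iUnion fun n =>
      MeasurableSet.iUnion fun _ => measurableSet_lt (hm n) measurable_const)
  have hTE : T ⁻¹' E ⊆ E := by
    intro x hx
    simp only [hE, Set.mem_preimage, Set.mem_iUnion, Set.mem_setOf_eq] at hx ⊢
    obtain ⟨q, hq, hf⟩ := hx
    obtain ⟨q', hq1, hq2⟩ := exists_rat_btwn hq
    refine ⟨q', hq2, ?_⟩
    have hev : ∀ᶠ n : ℕ in atTop, C - q' ≤ n * ((q' : ℝ) - q) := by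
      have : Tendsto (fun n : ℕ => (n : ℝ) * ((q' : ℝ) - q)) atTop atTop :=
        tendsto_natCast_atTop_atTop.atTop_mul_const (by linarith)
      exact this.eventually_ge_atTop _
    have h2 := hf.and_eventually hev
    rw [frequently_atTop] at h2 ⊢
    intro N
    obtain ⟨n, hn, h3, h4⟩ := h2 N
    refine ⟨1 + n, by omega, ?_⟩
    have h5 := hsub 1 n x
    have h6 := hC 1 x
    simp only [Function.iterate_one] at h5
    push_cast at h6 ⊢
    nlinarith
  rcases hT.ae_empty_or_univ_of_preimage_ae_le hEm.nullMeasurableSet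
    (HasSubset.Subset.eventuallyLE hTE) with h | h
  · have hn : ∀ᵐ x ∂μ, x ∉ E := by
      rw [ae_eq_empty] at h; exact measure_eq_zero_iff_ae_notMem.1 h
    filter_upwards [hn] with x hx
    simp only [hE, Set.mem_iUnion, Set.mem_setOf_eq, not_exists, not_and, not_frequently] at hx
    obtain ⟨q, hq1, hq2⟩ := exists_rat_btwn hcc'
    filter_upwards [hx q hq2] with n hn
    push Not at hn
    exact le_trans (by gcongr) hn
  · exfalso
    set B : ℕ → Set Ω := fun M => {x | ∀ n, 1 ≤ n → n ≤ M → n * c' ≤ F n x} with hBdef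
    have hBm : ∀ M, MeasurableSet (B M) := by
      intro M
      have : B M = ⋂ n : ℕ, ⋂ _ : 1 ≤ n, ⋂ _ : n ≤ M, {x | n * c' ≤ F n x} := by
        ext x; simp [hBdef]
      rw [this]
      exact MeasurableSet.iInter fun n => MeasurableSet.iInter fun _ => MeasurableSet.iInter fun _ =>
        measurableSet_le measurable_const (hm n)
    have hBa : Antitone B := fun M M' hMM x hx n h1 h2 => hx n h1 (h2.trans hMM)
    have hB0 : μ (⋂ M, B M) = 0 := by
      refine measure_mono_null (t := Eᶜ) ?_ ?_
      · intro x hx hxE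
        simp only [hE, Set.mem_iUnion, Set.mem_setOf_eq] at hxE
        obtain ⟨q, hq, hf⟩ := hxE
        obtain ⟨n, hn, h2⟩ := frequently_atTop.1 hf 1
        have h3 := Set.mem_iInter.1 hx n n hn le_rfl
        have : (n : ℝ) * q ≤ n * c' := by gcongr
        linarith
      · exact (ae_eq_univ.1 h)
    have hBt : Tendsto (fun M => μ.real (B M)) atTop (nhds 0) := by
      have := tendsto_measure_iInter_atTop (μ := μ) (fun M => (hBm M).nullMeasurableSet) hBa
        ⟨0, measure_ne_top _ _⟩
      rw [hB0] at this
      exact (ENNReal.tendsto_toReal ENNReal.zero_ne_top).comp this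
    have hBt' : Tendsto (fun M => C * μ.real (B M)) atTop (nhds 0) := by
      simpa using hBt.const_mul C
    obtain ⟨M, hM⟩ := (hBt'.eventually (gt_mem_nhds (show 0 < (r - c') / 2 by linarith))).exists
    have hgr := greedy_bound T F C hC0 hC hsub c' (hc.trans hcc'.le) M (B M) (by
      intro x hx
      simp only [hBdef, Set.mem_setOf_eq, not_forall, not_le] at hx
      obtain ⟨n, h1, h2, h3⟩ := hx
      exact ⟨n, h1, h2, h3.le⟩)
    have hIntg : ∀ i, Integrable (fun x => (B M).indicator (1 : Ω → ℝ) (T^[i] x)) μ := by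
      intro i
      exact ((hT.toMeasurePreserving.iterate i).integrable_comp_of_integrable
        ((integrable_const (1 : ℝ)).indicator (hBm M)))
    have hIntge : ∀ i, ∫ x, (B M).indicator (1 : Ω → ℝ) (T^[i] x) ∂μ = μ.real (B M) := by
      intro i
      have h1 := hT.toMeasurePreserving.iterate i
      have h2 : AEStronglyMeasurable ((B M).indicator (1 : Ω → ℝ)) (Measure.map (T^[i]) μ) :=
        (measurable_one.indicator (hBm M)).aestronglyMeasurable
      have := integral_map h1.measurable.aemeasurable h2
      rw [h1.map_eq] at this
      rw [← this, integral_indicator_one (hBm M)]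
    have hineq : ∀ n : ℕ, 1 ≤ n → n * r ≤ n * c' + C * (n * μ.real (B M)) + C * M := by
      intro n hn
      refine (hr n hn).trans ?_
      have hi2 : Integrable (fun x => n * c' + C * ∑ i ∈ Finset.range n,
          (B M).indicator (1 : Ω → ℝ) (T^[i] x) + C * M) μ :=
        (((integrable_const _).add ((integrable_finset_sum _ fun i _ => hIntg i).const_mul C))).add
          (integrable_const _)
      have hi1 : Integrable (F n) μ := by
        refine Integrable.of_bound (hm n).aestronglyMeasurable (C * n) ?_
        refine Eventually.of_forall fun x => ?_
        rw [Real.norm_of_nonneg (h0 n x)]; exact hC n x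
      refine (integral_mono hi1 hi2 (hgr n)).trans ?_
      have hs : Integrable (fun x => C * ∑ i ∈ Finset.range n,
          (B M).indicator (1 : Ω → ℝ) (T^[i] x)) μ :=
        (integrable_finset_sum _ fun i _ => hIntg i).const_mul C
      have hs2 : Integrable (fun x => n * c' + C * ∑ i ∈ Finset.range n,
          (B M).indicator (1 : Ω → ℝ) (T^[i] x)) μ := (integrable_const _).add hs
      rw [integral_add hs2 (integrable_const _),
        integral_add (integrable_const _) hs, integral_const_mul C,
        integral_finset_sum _ (fun i _ => hIntg i)]
      simp [hIntge]
    have hev : ∀ᶠ n : ℕ in atTop, C * M + 1 ≤ n * ((r - c') / 2) := by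
      have : Tendsto (fun n : ℕ => (n : ℝ) * ((r - c') / 2)) atTop atTop :=
        tendsto_natCast_atTop_atTop.atTop_mul_const (by linarith)
      exact this.eventually_ge_atTop _
    obtain ⟨n, hn, hn1⟩ := (hev.and (eventually_ge_atTop 1)).exists
    have h1 := hineq n hn1
    have h2 : (n : ℝ) * (C * μ.real (B M)) ≤ n * ((r - c') / 2) := by gcongr
    nlinarith

theorem birkhoff_upper (hT : Ergodic T μ) (f : Ω → ℝ) (hf : Measurable f) (C : ℝ)
    (h0 : ∀ x, 0 ≤ f x) (hC : ∀ x, f x ≤ C) (c : ℝ) (hc : ∫ x, f x ∂μ < c) :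
    ∀ᵐ x ∂μ, ∀ᶠ n : ℕ in atTop, ∑ i ∈ Finset.range n, f (T^[i] x) ≤ n * c := by
  have hTm : ∀ i, Measurable (T^[i]) := fun i => hT.toMeasurePreserving.measurable.iterate i
  have hfi : Integrable f μ := by
    refine Integrable.of_bound hf.aestronglyMeasurable C (Eventually.of_forall fun x => ?_)
    rw [Real.norm_of_nonneg (h0 x)]; exact hC x
  have hIntge : ∀ i, ∫ x, f (T^[i] x) ∂μ = ∫ x, f x ∂μ := by
    intro i
    have h1 := hT.toMeasurePreserving.iterate i
    have h2 : AEStronglyMeasurable f (Measure.map (T^[i]) μ) := hf.aestronglyMeasurable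
    have := integral_map h1.measurable.aemeasurable h2
    rw [h1.map_eq] at this
    exact this.symm
  have hIntg : ∀ i, Integrable (fun x => f (T^[i] x)) μ := fun i =>
    (hT.toMeasurePreserving.iterate i).integrable_comp_of_integrable hfi
  have := kingman_lower hT (fun n x => ∑ i ∈ Finset.range n, (C - f (T^[i] x)))
    (fun n => Finset.measurable_sum _ fun i _ => measurable_const.sub (hf.comp (hTm i))) C
    (fun n x => Finset.sum_nonneg fun i _ => by linarith [hC (T^[i] x)])
    (fun n x => by
      refine (Finset.sum_le_sum (g := fun _ => C) fun i _ => by linarith [h0 (T^[i] x)]).trans ?_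
      simp [mul_comm])
    (fun n m x => by
      rw [Finset.sum_range_add]
      refine le_of_eq (congrArg₂ _ rfl (Finset.sum_congr rfl fun i _ => ?_))
      rw [← Function.iterate_add_apply, add_comm])
    (C - ∫ x, f x ∂μ) (fun n hn => by
      have hs2 : ∀ i, Integrable (fun x => C - f (T^[i] x)) μ := fun i =>
        (integrable_const _).sub (hIntg i)
      rw [integral_finset_sum _ (fun i _ => hs2 i)]
      refine le_of_eq ?_
      rw [Finset.sum_congr rfl (fun i _ => integral_sub (integrable_const _) (hIntg i))]
      simp [hIntge, mul_sub]) (C - c) (by linarith)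
  filter_upwards [this] with x hx
  filter_upwards [hx] with n hn
  simp at hn
  linarith

end kingman
end EFS

namespace EFS

section windows
variable {A : Type*}

/-- Window of length `k` at position `i`. -/
def win (z : ℕ → A) (i k : ℕ) : List A := List.ofFn fun j : Fin k => z (i + j)

@[simp] theorem win_length (z : ℕ → A) (i k : ℕ) : (win z i k).length = k := by simp [win]

theorem win_zero (z : ℕ → A) (i : ℕ) : win z i 0 = [] := by simp [win]

theorem win_succ (z : ℕ → A) (i k : ℕ) : win z i (k + 1) = z i :: win z (i + 1) k := by
  unfold win
  rw [List.ofFn_succ]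
  congr 2
  funext j
  congr 1
  simp
  ring

theorem win_add (z : ℕ → A) (i k m : ℕ) : win z i (k + m) = win z i k ++ win z (i + k) m := by
  induction k generalizing i with
  | zero => simp [win_zero]
  | succ k ih =>
    rw [show k + 1 + m = (k + m) + 1 by ring, win_succ, win_succ, ih,
      show i + 1 + k = i + (k + 1) by ring]; rfl

theorem win_congr {z z' : ℕ → A} {i i' k : ℕ} (h : ∀ j < k, z (i + j) = z' (i' + j)) :
    win z i k = win z' i' k := by
  unfold win; congr 1; funext j; exact h j j.2

/-- Cyclic extension. -/
def cyc {n : ℕ} (hn : 0 < n) (y : Fin n → A) : ℕ → A := fun i => y ⟨i % n, Nat.mod_lt _ hn⟩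

theorem cyc_period {n : ℕ} (hn : 0 < n) (y : Fin n → A) (i : ℕ) : cyc hn y (i + n) = cyc hn y i := by
  simp [cyc]

theorem cyc_add_mul {n : ℕ} (hn : 0 < n) (y : Fin n → A) (i k : ℕ) :
    cyc hn y (i + n * k) = cyc hn y i := by
  simp [cyc]

theorem cyc_lt {n : ℕ} (hn : 0 < n) (y : Fin n → A) (i : Fin n) : cyc hn y i = y i := by
  simp [cyc, Nat.mod_eq_of_lt i.2]

theorem win_cyc {n : ℕ} (hn : 0 < n) (y : Fin n → A) (k : ℕ) :
    win (cyc hn y) (n * k) n = List.ofFn y := by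
  unfold win; congr 1; funext j
  rw [add_comm, cyc_add_mul, cyc_lt]

theorem sum_shift {n : ℕ} (f : ℕ → ℝ) (hf : ∀ i, f (i + n) = f i) (c : ℕ) :
    ∑ i ∈ Finset.range n, f (i + c) = ∑ i ∈ Finset.range n, f i := by
  induction c with
  | zero => simp
  | succ c ih =>
    rw [← ih]
    have h1 := Finset.sum_range_succ (fun i => f (i + c)) n
    have h2 := Finset.sum_range_succ' (fun i => f (i + c)) n
    have h3 : f (n + c) = f (0 + c) := by rw [add_comm n c, hf, zero_add]
    simp only [show ∀ i, i + (c + 1) = i + 1 + c from fun i => by ring]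
    linarith

variable [Fintype A] [DecidableEq A]

theorem emp_sum {n : ℕ} (hn : 0 < n) (k : ℕ) (y : Fin n → A) (h : (Fin k → A) → A → ℝ) :
    ∑ b : Fin k → A, ∑ a : A, empCount n k y a b * h b a =
      (∑ i ∈ Finset.range n, h (fun j => cyc hn y (i + (n - 1) * k + j)) (cyc hn y (i + n * k))) / n := by
  have hidx : ∀ (i : Fin n) (j : Fin k),
      y ⟨(i.val + (n - (k - j.val) % n)) % n, Nat.mod_lt _ i.pos⟩ =
        cyc hn y (i + (n - 1) * k + j) := by
    intro i j
    unfold cyc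
    congr 2
    apply Nat.ModEq.add_right_cancel' (k - j.val)
    have hj := j.2
    have e1 : i.val + (n - 1) * k + j.val + (k - j.val) = i.val + n * k := by
      have : (n - 1) * k + k = n * k := by
        obtain ⟨m, rfl⟩ : ∃ m, n = m + 1 := ⟨n - 1, by omega⟩
        simp; ring
      omega
    rw [e1]
    have e2 : i.val + n * k ≡ i.val [MOD n] := by simp [Nat.ModEq]
    refine Nat.ModEq.trans ?_ e2.symm
    have hlt := Nat.mod_lt (k - j.val) hn
    have e3 := Nat.mod_add_div (k - j.val) n
    have e4 : i.val + (n - (k - j.val) % n) + (k - j.val) =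
        i.val + n * (1 + (k - j.val) / n) := by
      rw [mul_add]; omega
    rw [e4]; simp [Nat.ModEq]
  have hcount : ∀ a b, empCount n k y a b =
      (∑ i : Fin n, if y i = a ∧ (fun j : Fin k => cyc hn y (i + (n - 1) * k + j)) = b
        then (1 : ℝ) else 0) / n := by
    intro a b
    unfold empCount
    rw [Finset.card_filter]
    push_cast
    congr 1
    refine Finset.sum_congr rfl fun i _ => ?_
    simp only [hidx, funext_iff]
  simp only [hcount]
  rw [Finset.sum_range]
  simp only [div_mul_eq_mul_div, Finset.sum_mul, ← Finset.sum_div]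
  congr 1
  rw [Finset.sum_congr rfl (fun b _ => Finset.sum_comm), Finset.sum_comm]
  refine Finset.sum_congr rfl fun i _ => ?_
  rw [Finset.sum_eq_single (fun j : Fin k => cyc hn y (i + (n - 1) * k + j)),
    Finset.sum_eq_single (y i)]
  · simp [cyc_add_mul, cyc_lt]
  · intro a _ ha; simp [ha.symm]
  · simp
  · intro b _ hb; simp [hb.symm]
  · simp

theorem empCount_nonneg {n k : ℕ} (y : Fin n → A) (a : A) (b : Fin k → A) :
    0 ≤ empCount n k y a b := by unfold empCount; positivity

theorem ent_le {n : ℕ} (hn : 0 < n) (k : ℕ) (y : Fin n → A) (θ : List A → A → ℝ)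
    (hθ : ∀ b a, b.length = k → 0 < θ b a) (hθ1 : ∀ b, b.length = k → ∑ a, θ b a ≤ 1) :
    n * condEmpEntropy n k y ≤ ∑ i ∈ Finset.range n,
      -Real.logb 2 (θ (win (cyc hn y) i k) (cyc hn y (i + k))) := by
  have hn' : (0 : ℝ) < n := by exact_mod_cast hn
  have e1 := emp_sum hn k y (fun b a => - Real.logb 2 (θ (List.ofFn b) a))
  have e2 : ∑ i ∈ Finset.range n, -Real.logb 2 (θ (win (cyc hn y) i k) (cyc hn y (i + k))) =
      n * ∑ b : Fin k → A, ∑ a : A, empCount n k y a b * - Real.logb 2 (θ (List.ofFn b) a) := by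
    rw [e1, mul_div_cancel₀ _ hn'.ne', ← sum_shift _ _ ((n - 1) * k)]
    · refine Finset.sum_congr rfl fun i _ => ?_
      have : i + (n - 1) * k + k = i + n * k := by
        obtain ⟨m, rfl⟩ : ∃ m, n = m + 1 := ⟨n - 1, by omega⟩
        simp; ring
      rw [this]; rfl
    · intro i
      congr 3
      · exact win_congr fun j _ => by rw [add_right_comm, cyc_period]
      · rw [add_right_comm, cyc_period]
  rw [e2]
  refine mul_le_mul_of_nonneg_left ?_ hn'.le
  unfold condEmpEntropy
  set S : (Fin k → A) → ℝ := fun b => ∑ a', empCount n k y a' b with hS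
  have hg := gibbs (Finset.univ : Finset ((Fin k → A) × A)) (fun p => empCount n k y p.2 p.1)
    (fun p => θ (List.ofFn p.1) p.2 * S p.1) (fun p _ => empCount_nonneg _ _ _)
    (fun p _ => mul_nonneg (hθ _ _ (by simp)).le (Finset.sum_nonneg fun a _ => empCount_nonneg _ _ _))
    (fun p _ hp => mul_pos (hθ _ _ (by simp)) (hp.trans_le
      (Finset.single_le_sum (f := fun a => empCount n k y a p.1)
        (fun a _ => empCount_nonneg _ _ _) (Finset.mem_univ _))))
    (by
      rw [Fintype.sum_prod_type, Fintype.sum_prod_type]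
      refine Finset.sum_le_sum fun b _ => ?_
      simp only []
      rw [← Finset.sum_mul]
      calc _ ≤ 1 * S b := mul_le_mul_of_nonneg_right (hθ1 _ (by simp))
            (Finset.sum_nonneg fun a _ => empCount_nonneg _ _ _)
        _ = _ := by rw [one_mul])
  rw [Fintype.sum_prod_type, Fintype.sum_prod_type] at hg
  have e3 : ∀ b a, empCount n k y a b * Real.logb 2 (empCount n k y a b / ∑ a', empCount n k y a' b) =
      empCount n k y a b * Real.logb 2 (empCount n k y a b) -
        empCount n k y a b * Real.logb 2 (S b) := by
    intro b a
    rcases (empCount_nonneg y a b).eq_or_lt with h | h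
    · rw [← h]; simp
    · have hSb : 0 < S b := h.trans_le (Finset.single_le_sum (f := fun a => empCount n k y a b)
        (fun a _ => empCount_nonneg _ _ _) (Finset.mem_univ _))
      rw [← mul_sub, ← Real.logb_div h.ne' hSb.ne']
  have e4 : ∀ b a, empCount n k y a b * Real.logb 2 (θ (List.ofFn b) a * S b) =
      empCount n k y a b * Real.logb 2 (θ (List.ofFn b) a) +
        empCount n k y a b * Real.logb 2 (S b) := by
    intro b a
    rcases (empCount_nonneg y a b).eq_or_lt with h | h
    · rw [← h]; simp
    · have hSb : 0 < S b := h.trans_le (Finset.single_le_sum (f := fun a => empCount n k y a b)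
        (fun a _ => empCount_nonneg _ _ _) (Finset.mem_univ _))
      rw [Real.logb_mul (hθ _ _ (by simp)).ne' hSb.ne', mul_add]
  simp only [e3, e4, Finset.sum_add_distrib, Finset.sum_sub_distrib, mul_neg,
    Finset.sum_neg_distrib] at hg ⊢
  linarith

/-- Product of conditional weights. -/
def PL (θ : List A → A → ℝ) : List A → List A → ℝ
  | _, [] => 1
  | p, a :: l => θ p a * PL θ (p ++ [a]) l

theorem PL_nonneg (θ : List A → A → ℝ) (h0 : ∀ p a, 0 ≤ θ p a) (p l : List A) : 0 ≤ PL θ p l := by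
  induction l generalizing p with
  | nil => simp [PL]
  | cons a l ih => exact mul_nonneg (h0 _ _) (ih _)

theorem PL_sum (θ : List A → A → ℝ) (h0 : ∀ p a, 0 ≤ θ p a) (h1 : ∀ p, ∑ a, θ p a ≤ 1)
    (n : ℕ) (p : List A) : sumL n (PL θ p) ≤ 1 := by
  induction n generalizing p with
  | zero => simp [sumL_zero, PL]
  | succ n ih =>
    rw [sumL_succ]
    simp only [PL, sumL_mul_left]
    refine le_trans (Finset.sum_le_sum fun a _ => ?_) (h1 p)
    exact mul_le_of_le_one_right (h0 _ _) (ih _)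

theorem PL_win (θ : List A → A → ℝ) (z : ℕ → A) (s n : ℕ) : ∀ m,
    PL θ (win z s m) (win z (s + m) n) =
      ∏ i ∈ Finset.range n, θ (win z s (m + i)) (z (s + m + i)) := by
  induction n with
  | zero => intro m; simp [win_zero, PL]
  | succ n ih =>
    intro m
    rw [win_succ, PL, Finset.prod_range_succ', mul_comm]
    have : win z s m ++ [z (s + m)] = win z s (m + 1) := by
      rw [win_add]; simp [win]
    rw [this, add_assoc s m 1, ih]
    simp only [add_zero, add_assoc, add_comm 1]

/-- Conditional weights from counts. -/
noncomputable def thN {k n : ℕ} (N : (Fin k → A) × A → Fin (n + 1)) (b : Fin k → A) (a : A) : ℝ :=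
  ((N (b, a) : ℕ) : ℝ) / ∑ a', ((N (b, a') : ℕ) : ℝ)

theorem count_bound [Nonempty A] {n : ℕ} (hn : 0 < n) (k : ℕ) :
    ∑ y : Fin n → A, (2 : ℝ) ^ (-(n * condEmpEntropy n k y)) ≤
      ((n : ℝ) + 1) ^ (Fintype.card A ^ (k + 1)) * (Fintype.card A : ℝ) ^ k := by
  have hn' : (0 : ℝ) < n := by exact_mod_cast hn
  obtain ⟨a0⟩ := ‹Nonempty A›
  set th' : ((Fin k → A) × A → Fin (n + 1)) → List A → A → ℝ := fun N p a =>
    thN N (fun j => (p.drop (p.length - k)).getD j a0) a with hth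
  have h0 : ∀ N p a, 0 ≤ th' N p a := by
    intro N p a; simp only [hth, thN]; positivity
  have h1 : ∀ N p, ∑ a, th' N p a ≤ 1 := by
    intro N p; simp only [hth, thN]
    rw [← Finset.sum_div]; exact div_self_le_one _
  have key : ∀ y : Fin n → A, (2 : ℝ) ^ (-(n * condEmpEntropy n k y)) ≤
      ∑ N : (Fin k → A) × A → Fin (n + 1), ∑ b : Fin k → A,
        PL (th' N) (List.ofFn b) (List.ofFn y) := by
    intro y
    set z := cyc hn y with hz
    have hcard : ∀ a (b : Fin k → A), (Finset.univ.filter fun i : Fin n =>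
      y i = a ∧ ∀ j : Fin k,
        y ⟨(i.val + (n - (k - j.val) % n)) % n, Nat.mod_lt _ i.pos⟩ = b j).card < n + 1 := by
      intro a b
      have := Finset.card_filter_le (Finset.univ : Finset (Fin n)) (fun i : Fin n =>
        y i = a ∧ ∀ j : Fin k,
        y ⟨(i.val + (n - (k - j.val) % n)) % n, Nat.mod_lt _ i.pos⟩ = b j)
      simp at this; omega
    set N : (Fin k → A) × A → Fin (n + 1) := fun p => ⟨_, hcard p.2 p.1⟩ with hN
    have hNe : ∀ b a, empCount n k y a b = ((N (b, a) : ℕ) : ℝ) / n := fun b a => rfl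
    have hratio : ∀ b a, empCount n k y a b / ∑ a', empCount n k y a' b = thN N b a := by
      intro b a
      simp only [hNe, thN, ← Finset.sum_div]
      rw [div_div_div_cancel_right₀ hn'.ne']
    have hpos : ∀ i ∈ Finset.range n, 0 < thN N (fun j => z (i + (n - 1) * k + j)) (z (i + n * k)) := by
      intro i hi
      by_contra hcon
      have e := emp_sum hn k y (fun b a => if thN N b a ≤ 0 then 1 else 0)
      have hz0 : ∑ b : Fin k → A, ∑ a : A,
          empCount n k y a b * (if thN N b a ≤ 0 then 1 else 0) = 0 := by
        refine Finset.sum_eq_zero fun b _ => Finset.sum_eq_zero fun a _ => ?_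
        split_ifs with h
        · rcases (empCount_nonneg y a b).eq_or_lt with h' | h'
          · rw [← h']; simp
          · exfalso
            rw [← hratio] at h
            have hSb : 0 < ∑ a', empCount n k y a' b :=
              h'.trans_le (Finset.single_le_sum (f := fun a => empCount n k y a b)
              (fun a _ => empCount_nonneg _ _ _) (Finset.mem_univ _))
            exact absurd h (not_le.2 (div_pos h' hSb))
        · simp
      rw [hz0] at e
      have e' := (div_eq_zero_iff.1 e.symm).resolve_right hn'.ne'
      rw [Finset.sum_eq_zero_iff_of_nonneg (fun i _ => by split_ifs <;> norm_num)] at e'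
      have := e' i hi
      rw [if_pos (not_lt.1 hcon)] at this
      norm_num at this
    have hH : (2 : ℝ) ^ (-(n * condEmpEntropy n k y)) =
        ∏ i ∈ Finset.range n, thN N (fun j => z (i + (n - 1) * k + j)) (z (i + n * k)) := by
      have : -(n * condEmpEntropy n k y) = ∑ i ∈ Finset.range n,
          Real.logb 2 (thN N (fun j => z (i + (n - 1) * k + j)) (z (i + n * k))) := by
        unfold condEmpEntropy
        simp only [hratio]
        rw [emp_sum hn k y (fun b a => Real.logb 2 (thN N b a))]
        field_simp
        rfl
      rw [this, Real.rpow_sum_of_pos (by norm_num)]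
      refine Finset.prod_congr rfl fun i hi => ?_
      rw [Real.rpow_logb (by norm_num) (by norm_num) (hpos i hi)]
    have hPL : (2 : ℝ) ^ (-(n * condEmpEntropy n k y)) =
        PL (th' N) (win z ((n - 1) * k) k) (List.ofFn y) := by
      have e1 : (n - 1) * k + k = n * k := by
        obtain ⟨m, rfl⟩ : ∃ m, n = m + 1 := ⟨n - 1, by omega⟩
        simp; ring
      rw [hH, ← win_cyc hn y k, ← e1, PL_win]
      refine Finset.prod_congr rfl fun i hi => ?_
      simp only [hth]
      have e2 : (win z ((n - 1) * k) (k + i)).drop ((win z ((n - 1) * k) (k + i)).length - k) =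
          win z ((n - 1) * k + i) k := by
        rw [add_comm k i, win_add]; simp
      rw [e2]
      congr 1
      · funext j
        have hj := j.2
        simp [win, List.getD_eq_getElem?_getD, hj]
        congr 1; ring
      · congr 1; rw [e1]; ring
    rw [hPL]
    refine le_trans ?_ (Finset.single_le_sum (f := fun N => ∑ b : Fin k → A,
        PL (th' N) (List.ofFn b) (List.ofFn y))
        (fun N _ => Finset.sum_nonneg fun b _ => PL_nonneg _ (h0 N) _ _) (Finset.mem_univ N))
    exact Finset.single_le_sum (f := fun b : Fin k → A => PL (th' N) (List.ofFn b) (List.ofFn y))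
        (fun b _ => PL_nonneg _ (h0 N) _ _) (Finset.mem_univ
          (fun j : Fin k => z ((n - 1) * k + j)))
  calc _ ≤ ∑ y : Fin n → A, ∑ N : (Fin k → A) × A → Fin (n + 1), ∑ b : Fin k → A,
        PL (th' N) (List.ofFn b) (List.ofFn y) := Finset.sum_le_sum fun y _ => key y
    _ = ∑ N : (Fin k → A) × A → Fin (n + 1), ∑ b : Fin k → A,
        sumL n (PL (th' N) (List.ofFn b)) := by
        rw [Finset.sum_comm]
        refine Finset.sum_congr rfl fun N _ => ?_
        rw [Finset.sum_comm]; rfl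
    _ ≤ ∑ N : (Fin k → A) × A → Fin (n + 1), ∑ b : Fin k → A, 1 :=
        Finset.sum_le_sum fun N _ => Finset.sum_le_sum fun b _ => PL_sum _ (h0 N) (h1 N) _ _
    _ = _ := by
        simp [pow_succ]

/-- Conditional empirical entropies are bounded by averaged block code lengths. -/
theorem win_entropy {n : ℕ} (hn : 0 < n) (y : Fin n → A) (Q : List A → ℝ) (hQ : ∀ l, 0 < Q l)
    (K : ℕ) (hQ1 : sumL K Q ≤ 1) (k : ℕ) (hk : K ≤ k + 1) [Nonempty A] :
    K * (n * condEmpEntropy n k y) ≤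
      ∑ i ∈ Finset.range n, -Real.logb 2 (Q (win (cyc hn y) i K)) := by
  set z := cyc hn y with hz
  set q : ℕ → List A → ℝ := fun j b => sumL (K - j) (fun c => Q (b ++ c)) with hq
  have hqpos : ∀ j b, 0 < q j b := fun j b =>
    Finset.sum_pos (fun y _ => hQ _) Finset.univ_nonempty
  have hqs : ∀ j, j < K → ∀ b, ∑ a, q (j + 1) (b ++ [a]) = q j b := by
    intro j hj b
    simp only [hq]
    rw [show K - j = (K - (j + 1)) + 1 by omega, sumL_succ]
    simp
  have hzp : ∀ i, z (i + n) = z i := cyc_period hn y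
  have hstep : ∀ j ∈ Finset.range K, n * condEmpEntropy n k y ≤ ∑ i ∈ Finset.range n,
      -(Real.logb 2 (q (j + 1) (win z i (j + 1))) - Real.logb 2 (q j (win z i j))) := by
    intro j hj
    have hj : j < K := Finset.mem_range.1 hj
    have h := ent_le hn k y (fun b a => q (j + 1) (b.drop (k - j) ++ [a]) / q j (b.drop (k - j)))
      (fun b a _ => div_pos (hqpos _ _) (hqpos _ _))
      (fun b _ => by rw [← Finset.sum_div, hqs j hj, div_self (hqpos _ _).ne'])
    refine h.trans (le_of_eq ?_)
    rw [← sum_shift (fun i => -(Real.logb 2 (q (j + 1) (win z i (j + 1))) -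
      Real.logb 2 (q j (win z i j)))) _ (k - j)]
    · refine Finset.sum_congr rfl fun i _ => ?_
      have e1 : (win z i k).drop (k - j) = win z (i + (k - j)) j := by
        conv_lhs => rw [show k = (k - j) + j by omega, win_add]
        simp
      have e2 : win z (i + (k - j)) j ++ [z (i + k)] = win z (i + (k - j)) (j + 1) := by
        rw [win_add, show i + (k - j) + j = i + k by omega]; simp [win]
      rw [← hz, e1, e2, Real.logb_div (hqpos _ _).ne' (hqpos _ _).ne']
    · intro i
      have : ∀ m, win z (i + n) m = win z i m := fun m =>
        win_congr fun j _ => by rw [add_right_comm, hzp]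
      simp only [this]
  have hsum := Finset.sum_le_sum hstep
  rw [Finset.sum_const, Finset.card_range, nsmul_eq_mul, Finset.sum_comm] at hsum
  refine hsum.trans (Finset.sum_le_sum fun i _ => ?_)
  rw [Finset.sum_neg_distrib, Finset.sum_range_sub (fun j => Real.logb 2 (q j (win z i j)))]
  have e1 : q K (win z i K) = Q (win z i K) := by simp [hq, sumL_zero]
  have e2 : Real.logb 2 (q 0 (win z i 0)) ≤ 0 := by
    refine Real.logb_nonpos (by norm_num) (hqpos _ _).le ?_
    simpa [hq, win_zero] using hQ1
  rw [e1]; linarith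

end windows
end EFS

namespace EFS

section dist
variable {X A : Type*}

/-- The left shift. -/
def shift (x : ℕ → X) : ℕ → X := fun i => x (i + 1)

theorem shift_iterate (n : ℕ) (x : ℕ → X) : shift^[n] x = fun i => x (i + n) := by
  induction n generalizing x with
  | zero => rfl
  | succ n ih => rw [Function.iterate_succ_apply, ih]; funext i; simp [shift]; congr 1

/-- Scaled total distortion between the start of `x` and a list. -/
def dl (d : X → A → ℝ) (α : ℝ) : (ℕ → X) → List A → ℝ
  | _, [] => 0
  | x, a :: l => α * d (x 0) a + dl d α (shift x) l

variable (d : X → A → ℝ) (α : ℝ)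

theorem dl_ofFn {n : ℕ} (x : ℕ → X) (y : Fin n → A) :
    dl d α x (List.ofFn y) = α * ∑ i : Fin n, d (x i) (y i) := by
  induction n generalizing x with
  | zero => simp [dl]
  | succ n ih =>
    rw [List.ofFn_succ, dl, ih, Fin.sum_univ_succ, mul_add]
    rfl

theorem dl_avg {n : ℕ} (hn : 0 < n) (x : ℕ → X) (y : Fin n → A) :
    dl d α x (List.ofFn y) = n * (α * avgDist d n (fun i => x i) y) := by
  have hn' : (0 : ℝ) < n := by exact_mod_cast hn
  rw [dl_ofFn, avgDist]; field_simp

theorem dl_append (x : ℕ → X) (u w : List A) :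
    dl d α x (u ++ w) = dl d α x u + dl d α (shift^[u.length] x) w := by
  induction u generalizing x with
  | nil => simp [dl]
  | cons a u ih =>
    rw [List.cons_append, dl, dl, ih, List.length_cons, Function.iterate_succ_apply]; ring

theorem dl_nonneg (hα : 0 ≤ α) (hd : ∀ a b, 0 ≤ d a b) (x : ℕ → X) (l : List A) :
    0 ≤ dl d α x l := by
  induction l generalizing x with
  | nil => simp [dl]
  | cons a l ih => rw [dl]; have := hd (x 0) a; have := ih (shift x); positivity

theorem dl_le (C : ℝ) (hC : ∀ a b, α * d a b ≤ C) (x : ℕ → X) (l : List A) :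
    dl d α x l ≤ C * l.length := by
  induction l generalizing x with
  | nil => simp [dl]
  | cons a l ih =>
    rw [dl]; have := hC (x 0) a; have := ih (shift x); push_cast [List.length_cons]; linarith

variable [MeasurableSpace X] [DiscreteMeasurableSpace X]

theorem measurable_shift : Measurable (shift : (ℕ → X) → ℕ → X) :=
  measurable_pi_lambda _ fun i => measurable_pi_apply (i + 1)

theorem dl_measurable (l : List A) : Measurable (fun x => dl d α x l) := by
  induction l with
  | nil => simp only [dl]; exact measurable_const
  | cons a l ih =>
    simp only [dl]
    have h1 : Measurable (fun x : ℕ → X => d (x 0) a) :=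
      (Measurable.of_discrete (f := fun u : X => d u a)).comp (measurable_pi_apply 0)
    exact (h1.const_mul α).add (ih.comp measurable_shift)

end dist

section conv
variable {X A : Type*} [Fintype X] [DecidableEq X] [MeasurableSpace X] [DiscreteMeasurableSpace X]
  [Fintype A] [DecidableEq A] [Nonempty A]
  (μ : Measure (ℕ → X)) [IsProbabilityMeasure μ] (d : X → A → ℝ) (α : ℝ)

theorem int_cyl (n : ℕ) (g : (Fin n → X) → ℝ) :
    ∫ x, g (fun i => x i) ∂μ =
      ∑ w : Fin n → X, (μ {x : ℕ → X | ∀ i : Fin n, x i.val = w i}).toReal * g w := by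
  have hπ : Measurable (fun (x : ℕ → X) (i : Fin n) => x i) :=
    measurable_pi_lambda _ fun i => measurable_pi_apply _
  have hg : Measurable g := measurable_of_finite g
  rw [← integral_map (φ := fun (x : ℕ → X) (i : Fin n) => x i) hπ.aemeasurable
    hg.aestronglyMeasurable]
  have : IsProbabilityMeasure (μ.map (fun (x : ℕ → X) (i : Fin n) => x i)) :=
    Measure.isProbabilityMeasure_map hπ.aemeasurable
  rw [integral_fintype Integrable.of_finite]
  refine Finset.sum_congr rfl fun w _ => ?_
  rw [smul_eq_mul, measureReal_def, Measure.map_apply hπ (measurableSet_singleton w)]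
  congr 3
  ext x; simp [funext_iff]

theorem sum_cyl (n : ℕ) :
    ∑ w : Fin n → X, (μ {x : ℕ → X | ∀ i : Fin n, x i.val = w i}).toReal = 1 := by
  have := int_cyl μ n (fun _ => 1)
  simpa using this.symm

/-- Every coupling gives an upper bound for the value of the variational problem. -/
theorem value_le (hα : 0 < α) (hd : ∀ a b, 0 ≤ d a b) (r : ℝ)
    (hr : (r : EReal) ≤ ⨅ (D : ℝ) (_ : 0 ≤ D), RDfun (Xh := A) μ d D + ((α * D : ℝ) : EReal))
    (n : ℕ) (hn : 1 ≤ n) (ν : (Fin n → X) × (Fin n → A) → ℝ) (h0 : ∀ p, 0 ≤ ν p)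
    (h1 : ∀ w : Fin n → X, ∑ y : Fin n → A, ν (w, y) =
      (μ {x : ℕ → X | ∀ i : Fin n, x i.val = w i}).toReal) :
    r ≤ mutualInfo ν / n + α * ∑ p, ν p * avgDist d n p.1 p.2 := by
  set D := ∑ p, ν p * avgDist d n p.1 p.2 with hD
  have hD0 : 0 ≤ D := Finset.sum_nonneg fun p _ => mul_nonneg (h0 p)
    (div_nonneg (Finset.sum_nonneg fun i _ => hd _ _) (by positivity))
  have h2 := hr.trans (iInf₂_le D hD0)
  have h3 : RDfun (Xh := A) μ d D ≤ ((mutualInfo ν / n : ℝ) : EReal) := by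
    unfold RDfun
    refine (iInf_le _ ⟨n, hn⟩).trans ?_
    unfold RDn
    refine sInf_le ⟨ν, h0, ?_, h1, le_rfl, rfl⟩
    rw [Fintype.sum_prod_type]; simp only [h1]; exact sum_cyl μ n
  have h4 := h2.trans (add_le_add_left h3 _)
  exact_mod_cast h4

theorem mean_converse (hα : 0 < α) (hd : ∀ a b, 0 ≤ d a b) (r : ℝ)
    (hr : (r : EReal) ≤ ⨅ (D : ℝ) (_ : 0 ≤ D), RDfun (Xh := A) μ d D + ((α * D : ℝ) : EReal))
    (n : ℕ) (hn : 1 ≤ n) (Q : List A → ℝ) (hQ : ∀ l, 0 < Q l) (hQ1 : sumL n Q ≤ 1) :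
    n * r ≤ ∫ x, ⨅ y : Fin n → A, (-Real.logb 2 (Q (List.ofFn y)) + dl d α x (List.ofFn y)) ∂μ := by
  have hn' : (0 : ℝ) < n := by exact_mod_cast hn
  set f : (Fin n → X) → (Fin n → A) → ℝ := fun w y =>
    -Real.logb 2 (Q (List.ofFn y)) + n * (α * avgDist d n w y) with hf
  have e0 : ∀ x : ℕ → X, ⨅ y : Fin n → A, (-Real.logb 2 (Q (List.ofFn y)) + dl d α x (List.ofFn y)) =
      (fun w => ⨅ y, f w y) (fun i => x i) := by
    intro x; simp only [hf]
    congr 1; funext y; rw [dl_avg d α hn]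
  simp only [e0]
  rw [int_cyl μ n (fun w => ⨅ y, f w y)]
  choose φ hφ using fun w => exists_eq_ciInf_of_finite (f := f w)
  simp only [← hφ]
  set P : (Fin n → X) → ℝ := fun w => (μ {x : ℕ → X | ∀ i : Fin n, x i.val = w i}).toReal with hP
  have hP0 : ∀ w, 0 ≤ P w := fun w => ENNReal.toReal_nonneg
  set ν : (Fin n → X) × (Fin n → A) → ℝ := fun p => if p.2 = φ p.1 then P p.1 else 0 with hν
  have hν0 : ∀ p, 0 ≤ ν p := fun p => by simp only [hν]; split_ifs <;> simp [hP0]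
  have hν1 : ∀ w, ∑ y, ν (w, y) = P w := fun w => by simp [hν]
  have hνg : ∀ g : (Fin n → X) → (Fin n → A) → ℝ,
      ∑ p : (Fin n → X) × (Fin n → A), ν p * g p.1 p.2 = ∑ w, P w * g w (φ w) := by
    intro g
    rw [Fintype.sum_prod_type]
    refine Finset.sum_congr rfl fun w _ => ?_
    simp [hν]
  have key := value_le μ d α hα hd r hr n hn ν hν0 hν1
  rw [hνg (avgDist d n)] at key
  have hI : mutualInfo ν = shannonEntropy (fun b => ∑ a, ν (a, b)) := by
    unfold mutualInfo
    have : shannonEntropy ν = shannonEntropy (fun a => ∑ b, ν (a, b)) := by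
      unfold shannonEntropy
      simp only [hν1]
      rw [← hνg (fun w y => Real.logb 2 (P w))]
      congr 1
      refine Finset.sum_congr rfl fun p _ => ?_
      by_cases h : p.2 = φ p.1 <;> simp [hν, h]
    rw [this]; ring
  have hν2 : ∀ y, 0 ≤ ∑ w, ν (w, y) := fun y => Finset.sum_nonneg fun w _ => hν0 _
  have hH : shannonEntropy (fun b => ∑ a, ν (a, b)) ≤
      ∑ w, P w * -Real.logb 2 (Q (List.ofFn (φ w))) := by
    have hg := gibbs Finset.univ (fun b => ∑ a, ν (a, b)) (fun y => Q (List.ofFn y))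
      (fun y _ => hν2 y) (fun y _ => (hQ _).le) (fun y _ _ => hQ _) (by
        refine hQ1.trans (le_of_eq ?_)
        rw [Finset.sum_comm]; simp only [hν1]; exact (sum_cyl μ n).symm)
    have e : ∑ w, P w * -Real.logb 2 (Q (List.ofFn (φ w))) =
        -∑ y : Fin n → A, (∑ w, ν (w, y)) * Real.logb 2 (Q (List.ofFn y)) := by
      rw [← hνg (fun w y => -Real.logb 2 (Q (List.ofFn y))), Fintype.sum_prod_type, Finset.sum_comm,
        ← Finset.sum_neg_distrib]
      refine Finset.sum_congr rfl fun y _ => ?_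
      rw [Finset.sum_mul, ← Finset.sum_neg_distrib]
      simp
    rw [e]; unfold shannonEntropy; linarith
  have e2 : ∑ w, P w * f w (φ w) = ∑ w, P w * -Real.logb 2 (Q (List.ofFn (φ w))) +
      n * (α * ∑ w, P w * avgDist d n w (φ w)) := by
    simp only [hf, mul_add, Finset.sum_add_distrib, Finset.mul_sum]
    congr 1
    refine Finset.sum_congr rfl fun w _ => ?_
    ring
  rw [e2]
  have h5 : (n : ℝ) * r ≤ mutualInfo ν + n * (α * ∑ w, P w * avgDist d n w (φ w)) := by
    calc (n : ℝ) * r ≤ n * (mutualInfo ν / n + α * ∑ w, P w * avgDist d n w (φ w)) := by gcongr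
      _ = _ := by field_simp
  linarith [hI ▸ hH]

end conv
end EFS

namespace EFS
section convas
variable {X A : Type*} [Fintype X] [DecidableEq X] [MeasurableSpace X] [DiscreteMeasurableSpace X]
    [Fintype A] [DecidableEq A] [Nonempty A]

theorem neglog_lin (Q : List A → ℝ) (hQ : ∀ l, 0 < Q l) (hnil : Q [] = 1)
    (hmul : ∀ u w, Q u * Q w ≤ Q (u ++ w)) (C : ℝ) (hC : ∀ a, -Real.logb 2 (Q [a]) ≤ C) (l : List A) :
    -Real.logb 2 (Q l) ≤ C * l.length := by
  induction l with
  | nil => simp [hnil]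
  | cons a l ih =>
    have h1 := Real.logb_le_logb_of_le (b := 2) (by norm_num) (mul_pos (hQ [a]) (hQ l)) (hmul [a] l)
    rw [Real.logb_mul (hQ _).ne' (hQ _).ne'] at h1
    have := hC a
    simp only [List.singleton_append] at h1
    simp only [List.length_cons, Nat.cast_add, Nat.cast_one]
    linarith

theorem as_lower (μ : Measure (ℕ → X)) [IsProbabilityMeasure μ] (hT : Ergodic (shift : (ℕ → X) → ℕ → X) μ)
    (d : X → A → ℝ) (α : ℝ) (hα : 0 < α) (hd : ∀ a b, 0 ≤ d a b) (r : ℝ)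
    (hr : (r : EReal) ≤ ⨅ (D : ℝ) (_ : 0 ≤ D), RDfun (Xh := A) μ d D + ((α * D : ℝ) : EReal))
    (Q : List A → ℝ) (hQ : ∀ l, 0 < Q l) (hnil : Q [] = 1)
    (hmul : ∀ u w, Q u * Q w ≤ Q (u ++ w)) (hQ1 : ∀ n, sumL n Q ≤ 1) (c : ℝ) (hc : c < r) :
    ∀ᵐ x ∂μ, ∀ᶠ n : ℕ in atTop, n * c ≤
      ⨅ y : Fin n → A, (-Real.logb 2 (Q (List.ofFn y)) + dl d α x (List.ofFn y)) := by
  obtain ⟨C1, hC1⟩ := (Set.finite_range (fun a => -Real.logb 2 (Q [a]))).bddAbove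
  obtain ⟨C2, hC2⟩ := (Set.finite_range (fun p : X × A => α * d p.1 p.2)).bddAbove
  have hC1' : ∀ a, -Real.logb 2 (Q [a]) ≤ C1 := fun a => hC1 ⟨a, rfl⟩
  have hC2' : ∀ a b, α * d a b ≤ C2 := fun a b => hC2 ⟨(a, b), rfl⟩
  have hle1 : ∀ l, Q l ≤ 1 := fun l => (le_sumL (fun l _ => (hQ l).le) rfl).trans (hQ1 l.length)
  have hb : ∀ (n : ℕ) (x : ℕ → X) (l : List A), l.length = n →
      (⨅ y : Fin n → A, (-Real.logb 2 (Q (List.ofFn y)) + dl d α x (List.ofFn y))) ≤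
      -Real.logb 2 (Q l) + dl d α x l := by
    intro n x l hl
    obtain ⟨y, rfl⟩ := exists_ofFn hl
    exact ciInf_le (Set.finite_range _).bddBelow y
  refine kingman_lower hT (fun n x => ⨅ y : Fin n → A,
      (-Real.logb 2 (Q (List.ofFn y)) + dl d α x (List.ofFn y))) ?_ (C1 + C2) ?_ ?_ ?_ r ?_ c hc
  · intro n
    exact Measurable.iInf fun y => (dl_measurable d α _).const_add _
  · intro n x
    refine le_ciInf fun y => add_nonneg ?_ (dl_nonneg d α hα.le hd x _)
    have := Real.logb_nonpos (b := 2) (by norm_num) (hQ _).le (hle1 (List.ofFn y))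
    linarith
  · intro n x
    let a0 : A := Classical.arbitrary A
    refine (hb n x (List.replicate n a0) (by simp)).trans ?_
    have h1 := neglog_lin Q hQ hnil hmul C1 hC1' (List.replicate n a0)
    have h2 := dl_le d α C2 hC2' x (List.replicate n a0)
    simp only [List.length_replicate] at h1 h2
    linarith
  · intro n m x
    obtain ⟨u, hu⟩ := exists_eq_ciInf_of_finite (f := fun y : Fin n → A => 
      (-Real.logb 2 (Q (List.ofFn y)) + dl d α x (List.ofFn y)))
    obtain ⟨w, hw⟩ := exists_eq_ciInf_of_finite (f := fun y : Fin m → A => 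
      (-Real.logb 2 (Q (List.ofFn y)) + dl d α (shift^[n] x) (List.ofFn y)))
    simp only [← hu, ← hw]
    refine (hb (n + m) x (List.ofFn u ++ List.ofFn w) (by simp)).trans ?_
    rw [dl_append]
    have h1 := Real.logb_le_logb_of_le (b := 2) (by norm_num) (mul_pos (hQ _) (hQ _))
      (hmul (List.ofFn u) (List.ofFn w))
    rw [Real.logb_mul (hQ _).ne' (hQ _).ne'] at h1
    simp only [List.length_ofFn]
    linarith
  · intro n hn
    exact mean_converse μ d α hα hd r hr n hn Q hQ (hQ1 n)

/-- normalisation of the enumerative code. -/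
noncomputable def nrm (A : Type*) [Fintype A] (kn : ℕ → ℕ) (m : ℕ) : ℝ :=
  ((m : ℝ) + 1) ^ (Fintype.card A ^ (kn m + 1)) * (Fintype.card A : ℝ) ^ (kn m) * (m * (m + 1))

noncomputable def vv (kn : ℕ → ℕ) (l : List A) : ℝ :=
  (2 : ℝ) ^ (-(l.length * condEmpEntropy l.length (kn l.length) l.get)) / nrm A kn l.length

theorem vv_ofFn (kn : ℕ → ℕ) {n : ℕ} (y : Fin n → A) : vv kn (List.ofFn y) =
    (2 : ℝ) ^ (-(n * condEmpEntropy n (kn n) y)) / nrm A kn n := by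
  have : ∀ (l : List A) (n : ℕ) (y : Fin n → A), l = List.ofFn y → vv kn l =
    (2 : ℝ) ^ (-(n * condEmpEntropy n (kn n) y)) / nrm A kn n := by
    intro l n y h
    have hl : n = l.length := by simp [h]
    subst hl
    have : l.get = y := by
      apply List.ofFn_injective
      rw [← h, List.ofFn_get]
    subst this
    rfl
  exact this _ n y rfl

theorem nrm_pos (kn : ℕ → ℕ) {m : ℕ} (hm : 1 ≤ m) : 0 < nrm A kn m := by
  unfold nrm
  have h1 : (0 : ℝ) < Fintype.card A := by exact_mod_cast Fintype.card_pos
  have h2 : (0 : ℝ) < m := by exact_mod_cast hm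
  positivity

theorem nrm_nonneg (kn : ℕ → ℕ) (m : ℕ) : 0 ≤ nrm A kn m := by
  unfold nrm
  positivity

theorem vv_nonneg (kn : ℕ → ℕ) (l : List A) : 0 ≤ vv kn l := 
  div_nonneg (by positivity) (nrm_nonneg _ _)

theorem vv_sum (kn : ℕ → ℕ) (m : ℕ) : sumL (m + 1) (vv (A := A) kn) ≤ 1 / ((m + 1 : ℝ)) - 1 / (m + 2) := by
  unfold sumL
  simp only [vv_ofFn]
  rw [← Finset.sum_div, div_le_iff₀ (nrm_pos kn (by omega))]
  refine (count_bound (by omega) _).trans (le_of_eq ?_)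
  unfold nrm
  push_cast
  field_simp
  ring

theorem tele (n : ℕ) : ∑ m ∈ Finset.range n, (1 / ((m + 1 : ℝ)) - 1 / (m + 2)) ≤ 1 := by
  have : ∑ m ∈ Finset.range n, (1 / ((m + 1 : ℝ)) - 1 / (m + 2)) = 1 - 1 / (n + 1) := by
    induction n with
    | zero => simp
    | succ n ih => rw [Finset.sum_range_succ, ih]; push_cast; ring
  rw [this]
  have : (0:ℝ) ≤ 1 / ((n:ℝ) + 1) := by positivity
  linarith

theorem log_nrm (kn : ℕ → ℕ) (hkn2 : Tendsto (fun n => (kn n : ℝ) / Real.log n) atTop (nhds 0)) :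
    Tendsto (fun n : ℕ => Real.logb 2 (nrm A kn n) / n) atTop (nhds 0) := by
  set a : ℝ := (Fintype.card A : ℝ) with ha
  have ha1 : 1 ≤ a := by
    have : 1 ≤ Fintype.card A := Fintype.card_pos
    rw [ha]; exact_mod_cast this
  have ha0 : 0 < a := by linarith
  have hla : 0 ≤ Real.log a := Real.log_nonneg ha1
  have hl2 : 0 < Real.log 2 := Real.log_pos (by norm_num)
  have h0 : 0 < 1 / (2 * (Real.log a + 1)) := by positivity
  have hev := hkn2.eventually (gt_mem_nhds h0)
  have hlim : Tendsto (fun n : ℕ => (8 * (a + 3) / Real.log 2) * (n : ℝ) ^ (-(1/4 : ℝ))) atTop (nhds 0) := by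
    have := (tendsto_rpow_neg_atTop (y := 1/4) (by norm_num)).comp (tendsto_natCast_atTop_atTop (R := ℝ))
    simpa using this.const_mul (8 * (a + 3) / Real.log 2)
  have key : ∀ᶠ n : ℕ in atTop, 0 ≤ Real.logb 2 (nrm A kn n) / n ∧ 
      Real.logb 2 (nrm A kn n) / n ≤ (8 * (a + 3) / Real.log 2) * (n : ℝ) ^ (-(1/4 : ℝ)) := by
    filter_upwards [hev, eventually_ge_atTop 2] with n hn hn2
    have hn2' : (2 : ℝ) ≤ n := by exact_mod_cast hn2
    have hn0 : (0 : ℝ) < n := by linarith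
    have hlog : 0 < Real.log n := Real.log_pos (by linarith)
    have hlog' : Real.log n ≤ Real.log (n + 1) := Real.log_le_log hn0 (by linarith)
    rw [div_lt_iff₀ hlog] at hn
    have hk : kn n * Real.log a ≤ 1/2 * Real.log n := by
      have h1 : kn n * Real.log a ≤ 1 / (2 * (Real.log a + 1)) * Real.log n * Real.log a := 
        mul_le_mul_of_nonneg_right hn.le hla
      have h2 : 1 / (2 * (Real.log a + 1)) * Real.log a ≤ 1/2 := by
        rw [div_mul_eq_mul_div, div_le_div_iff₀ (by positivity) (by norm_num)]
        linarith
      nlinarith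
    have hpow : a ^ (kn n) ≤ (n:ℝ) ^ (1/2 : ℝ) := by
      rw [← Real.exp_log (pow_pos ha0 (kn n)), Real.log_pow, Real.rpow_def_of_pos hn0]
      exact Real.exp_le_exp.2 (by linarith)
    have e : Real.log (nrm A kn n) = a ^ (kn n + 1) * Real.log (n + 1) + kn n * Real.log a + 
        (Real.log n + Real.log (n + 1)) := by
      unfold nrm
      rw [Real.log_mul (by positivity) (by positivity), Real.log_mul (by positivity) (by positivity),
        Real.log_mul (by positivity) (by positivity), Real.log_pow, Real.log_pow]
      push_cast; rfl
    have hr1 : (1:ℝ) ≤ (n:ℝ) ^ (1/2 : ℝ) := Real.one_le_rpow (by linarith) (by norm_num)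
    have hup : Real.log (nrm A kn n) ≤ ((a + 3) * (n:ℝ) ^ (1/2 : ℝ)) * Real.log (n + 1) := by
      have h1 : a ^ (kn n + 1) ≤ a * (n:ℝ) ^ (1/2 : ℝ) := by
        rw [pow_succ, mul_comm]; gcongr
      have h2 : a ^ (kn n + 1) * Real.log (n + 1) ≤ (a * (n:ℝ) ^ (1/2 : ℝ)) * Real.log (n + 1) := by
        gcongr; linarith
      have h3 : 1 * Real.log (n+1) ≤ (n:ℝ) ^ (1/2 : ℝ) * Real.log (n + 1) := by
        gcongr; linarith
      rw [e]; nlinarith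
    have hlg : Real.log (n + 1) ≤ 8 * (n:ℝ) ^ (1/4:ℝ) := by
      have h1 := Real.log_le_rpow_div (x := (n:ℝ) + 1) (ε := 1/4) (by linarith) (by norm_num)
      have h2 : ((n:ℝ) + 1) ^ (1/4:ℝ) ≤ (16 * n) ^ (1/4:ℝ) := 
        Real.rpow_le_rpow (by linarith) (by linarith) (by norm_num)
      rw [Real.mul_rpow (by norm_num) hn0.le] at h2
      have h3 : (16:ℝ) ^ (1/4:ℝ) = 2 := by
        rw [show (16:ℝ) = 2 ^ (4:ℝ) by norm_num, ← Real.rpow_mul (by norm_num)]; norm_num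
      rw [h3] at h2
      linarith
    constructor
    · unfold Real.logb
      rw [e]
      have : 0 ≤ Real.log ((n:ℝ)+1) := by linarith
      positivity
    · unfold Real.logb
      have h4 : Real.log (nrm A kn n) ≤ ((a + 3) * (n:ℝ) ^ (1/2 : ℝ)) * (8 * (n:ℝ) ^ (1/4:ℝ)) := 
        hup.trans (by gcongr)
      have h5 : (n:ℝ) ^ (1/2 : ℝ) * (n:ℝ) ^ (1/4:ℝ) = n * (n : ℝ) ^ (-(1/4 : ℝ)) := by
        rw [← Real.rpow_add hn0]
        nth_rw 2 [← Real.rpow_one (n:ℝ)]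
        rw [← Real.rpow_add hn0]; norm_num
      rw [div_div, div_le_iff₀ (by positivity)]
      have : 8 * (a + 3) / Real.log 2 * (n:ℝ) ^ (-(1/4:ℝ)) * (Real.log 2 * n) = 8 * (a + 3) * (n * (n : ℝ) ^ (-(1/4 : ℝ))) := by
        field_simp
      rw [this, ← h5]; linarith
  exact tendsto_of_tendsto_of_tendsto_of_le_of_le' tendsto_const_nhds hlim (key.mono fun _ h => h.1)
    (key.mono fun _ h => h.2)

theorem converse (μ : Measure (ℕ → X)) [IsProbabilityMeasure μ] (hT : Ergodic (shift : (ℕ → X) → ℕ → X) μ)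
    (d : X → A → ℝ) (α : ℝ) (hα : 0 < α) (hd : ∀ a b, 0 ≤ d a b) 
    (kn : ℕ → ℕ) (hkn2 : Tendsto (fun n => (kn n : ℝ) / Real.log n) atTop (nhds 0)) (r : ℝ)
    (hr : (r : EReal) ≤ ⨅ (D : ℝ) (_ : 0 ≤ D), RDfun (Xh := A) μ d D + ((α * D : ℝ) : EReal))
    (c : ℝ) (hc : c < r) :
    ∀ᵐ x ∂μ, ∀ᶠ n : ℕ in atTop, c ≤
      ⨅ y : Fin n → A, (condEmpEntropy n (kn n) y + α * avgDist d n (fun i : Fin n => x i.val) y) := by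
  obtain ⟨c', hc1, hc2⟩ := exists_between hc
  have h := as_lower μ hT d α hα hd r hr (ren (vv kn)) 
    (ren_pos (vv_nonneg kn) (fun a => by
      unfold vv; exact div_pos (by positivity) (nrm_pos kn (by simp)))) ren_nil
    (fun u w => ren_append (vv_nonneg kn) w _ u rfl)
    (ren_kraft (vv_nonneg kn) _ (vv_sum kn) tele) c' hc2
  filter_upwards [h] with x hx
  have hl := (log_nrm (A := A) kn hkn2).eventually (gt_mem_nhds (sub_pos.2 hc1))
  filter_upwards [hx, hl, eventually_ge_atTop 1] with n h1 h2 hn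
  refine le_ciInf fun y => ?_
  have hn0 : (0 : ℝ) < n := by exact_mod_cast hn
  have h3 := h1.trans (ciInf_le (Set.finite_range _).bddBelow y)
  have h4 : vv kn (List.ofFn y) ≤ ren (vv kn) (List.ofFn y) := le_ren (vv_nonneg kn) (by
    intro h; have := congrArg List.length h; simp at this; omega)
  have hp : 0 < vv kn (List.ofFn y) := by
    rw [vv_ofFn]; exact div_pos (by positivity) (nrm_pos kn hn)
  have h5 := Real.logb_le_logb_of_le (b := 2) (by norm_num) hp h4
  rw [vv_ofFn, Real.logb_div (by positivity) (nrm_pos kn hn).ne', Real.logb_rpow (by norm_num) (by norm_num)] at h5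
  rw [dl_avg d α hn] at h3
  rw [div_lt_iff₀ hn0] at h2
  have : n * c ≤ n * (condEmpEntropy n (kn n) y + α * avgDist d n (fun i : Fin n => x i.val) y) := by
    nlinarith
  exact le_of_mul_le_mul_left this hn0
end convas
end EFS

namespace EFS
section rc
variable {V : Type*} [Fintype V] [DecidableEq V]

theorem S_bounds (q δ : V → ℝ) (hq : ∀ v, 0 ≤ q v) (hq1 : ∑ v, q v = 1) (B : ℝ) (h0 : ∀ v, 0 ≤ δ v)
    (hB : ∀ v, δ v ≤ B) : (2:ℝ) ^ (-B) ≤ ∑ v, q v * (2:ℝ) ^ (-δ v) ∧ ∑ v, q v * (2:ℝ) ^ (-δ v) ≤ 1 := by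
  constructor
  · calc (2:ℝ) ^ (-B) = ∑ v, q v * (2:ℝ) ^ (-B) := by rw [← Finset.sum_mul, hq1, one_mul]
      _ ≤ _ := Finset.sum_le_sum fun v _ => mul_le_mul_of_nonneg_left
        (Real.rpow_le_rpow_of_exponent_le (by norm_num) (by linarith [hB v])) (hq v)
  · calc ∑ v, q v * (2:ℝ) ^ (-δ v) ≤ ∑ v, q v * 1 := Finset.sum_le_sum fun v _ =>
          mul_le_mul_of_nonneg_left (Real.rpow_le_one_of_one_le_of_nonpos (by norm_num) (by linarith [h0 v])) (hq v)
      _ = 1 := by simp [hq1]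

theorem Z_bounds (q δ : V → ℝ) (hq : ∀ v, 0 ≤ q v) (hq1 : ∑ v, q v = 1) (B : ℝ) (h0 : ∀ v, 0 ≤ δ v)
    (hB : ∀ v, δ v ≤ B) : 0 ≤ -Real.logb 2 (∑ v, q v * (2:ℝ) ^ (-δ v)) ∧
      -Real.logb 2 (∑ v, q v * (2:ℝ) ^ (-δ v)) ≤ B := by
  obtain ⟨h1, h2⟩ := S_bounds q δ hq hq1 B h0 hB
  have hp : 0 < (2:ℝ) ^ (-B) := by positivity
  constructor
  · have := Real.logb_nonpos (b := 2) (by norm_num) (hp.le.trans h1) h2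
    linarith
  · have := Real.logb_le_logb_of_le (b := 2) (by norm_num) hp h1
    rw [Real.logb_rpow (by norm_num) (by norm_num)] at this
    linarith

theorem rc_one (q δ : V → ℝ) (hq : ∀ v, 0 ≤ q v) (hq1 : ∑ v, q v = 1) (B : ℝ) (h0 : ∀ v, 0 ≤ δ v)
    (hB : ∀ v, δ v ≤ B) (s : ℝ) (hs : 0 ≤ s) (K : ℕ) (hK : (2:ℝ) ^ (B + s) ≤ K) :
    ∑ Y : Fin K → V, (∏ j, q (Y j)) * (⨅ j : Fin K, (Real.logb 2 (j + 1) + δ (Y j))) ≤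
      -Real.logb 2 (∑ v, q v * (2:ℝ) ^ (-δ v)) + s + Real.exp (1 - (2:ℝ) ^ s) * B := by
  obtain ⟨hZ0, hZB⟩ := Z_bounds q δ hq hq1 B h0 hB
  have hSp : 0 < ∑ v, q v * (2:ℝ) ^ (-δ v) :=
    lt_of_lt_of_le (by positivity) (S_bounds q δ hq hq1 B h0 hB).1
  set S := ∑ v, q v * (2:ℝ) ^ (-δ v) with hS
  set t := -Real.logb 2 S + s with ht
  have hV : ∃ v : V, True := by
    by_contra h
    push Not at h
    have : IsEmpty V := ⟨fun v => (h v).elim⟩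
    simp at hq1
  obtain ⟨v0, -⟩ := hV
  have hB0 : 0 ≤ B := (h0 v0).trans (hB v0)
  have hK1 : (1:ℝ) ≤ K := (Real.one_le_rpow (by norm_num) (by linarith)).trans hK
  have hK0 : 0 < K := by
    rcases Nat.eq_zero_or_pos K with h | h
    · subst h; norm_num at hK1
    · exact h
  have : Nonempty (Fin K) := ⟨⟨0, hK0⟩⟩
  let bad : Fin K → V → ℝ := fun j v => if Real.logb 2 ((j:ℕ) + 1) + δ v ≤ t then 0 else 1
  have hcost : ∀ Y : Fin K → V, (⨅ j : Fin K, (Real.logb 2 (j + 1) + δ (Y j))) ≤ t + B * ∏ j, bad j (Y j) := by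
    intro Y
    by_cases h : ∃ j : Fin K, Real.logb 2 ((j:ℕ) + 1) + δ (Y j) ≤ t
    · obtain ⟨j, hj⟩ := h
      have : ∏ j, bad j (Y j) = 0 := Finset.prod_eq_zero (Finset.mem_univ j) (by simp only [bad]; rw [if_pos hj])
      rw [this]
      refine (ciInf_le (Set.finite_range _).bddBelow j).trans ?_
      linarith
    · push Not at h
      have : ∏ j, bad j (Y j) = 1 := Finset.prod_eq_one fun j _ => by
        simp only [bad]; rw [if_neg (not_le.2 (h j))]
      rw [this]
      refine (ciInf_le (Set.finite_range _).bddBelow ⟨0, hK0⟩).trans ?_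
      have := hB (Y ⟨0, hK0⟩)
      simp
      linarith
  have hprod : ∀ f : Fin K → V → ℝ, ∑ Y : Fin K → V, ∏ j, f j (Y j) = ∏ j, ∑ v, f j v := by
    intro f
    rw [Finset.prod_univ_sum, Fintype.piFinset_univ]
  have hπ0 : ∀ Y : Fin K → V, 0 ≤ ∏ j, q (Y j) := fun Y => Finset.prod_nonneg fun j _ => hq _
  have hπ1 : ∑ Y : Fin K → V, ∏ j, q (Y j) = 1 := by
    rw [hprod (fun _ => q)]; simp [hq1]
  have hbadsum : ∑ Y : Fin K → V, (∏ j, q (Y j)) * ∏ j, bad j (Y j) ≤ Real.exp (1 - (2:ℝ) ^ s) := by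
    simp only [← Finset.prod_mul_distrib]
    rw [hprod (fun j v => q v * bad j v)]
    have e1 : ∀ j, ∑ v, q v * bad j v = 1 - ∑ v, q v * (1 - bad j v) := by
      intro j
      simp only [mul_sub, mul_one, Finset.sum_sub_distrib, hq1]; ring
    have e2 : ∀ j, 0 ≤ ∑ v, q v * bad j v := fun j => Finset.sum_nonneg fun v _ =>
      mul_nonneg (hq v) (by simp only [bad]; split_ifs <;> norm_num)
    calc ∏ j, ∑ v, q v * bad j v ≤ ∏ j, Real.exp (- ∑ v, q v * (1 - bad j v)) := by
          refine Finset.prod_le_prod (fun j _ => e2 j) fun j _ => ?_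
          rw [e1]
          have := Real.add_one_le_exp (- ∑ v, q v * (1 - bad j v))
          linarith
      _ = Real.exp (∑ j, - ∑ v, q v * (1 - bad j v)) := (Real.exp_sum _ _).symm
      _ ≤ _ := by
        refine Real.exp_le_exp.2 ?_
        rw [Finset.sum_neg_distrib, Finset.sum_comm]
        have hcount : ∀ v, (2:ℝ) ^ (t - δ v) - 1 ≤ ∑ j : Fin K, (1 - bad j v) := by
          intro v
          set u := (2:ℝ) ^ (t - δ v) with hu
          have hu0 : 0 < u := by positivity
          have huK : ⌊u⌋₊ ≤ K := by
            have : u ≤ K := le_trans (Real.rpow_le_rpow_of_exponent_le (by norm_num) (by linarith [h0 v])) hK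
            exact Nat.floor_le_of_le this
          have h1 : ∀ j : Fin K, (if (j:ℕ) < ⌊u⌋₊ then (1:ℝ) else 0) ≤ 1 - bad j v := by
            intro j
            simp only [bad]
            split_ifs with ha hb hb <;> norm_num
            apply hb
            have h2 : ((j:ℕ) + 1 : ℝ) ≤ u := by
              have : ((j:ℕ) + 1 : ℕ) ≤ ⌊u⌋₊ := ha
              have h3 := (Nat.cast_le (α := ℝ)).2 this
              push_cast at h3
              exact h3.trans (Nat.floor_le hu0.le)
            have h4 := Real.logb_le_logb_of_le (b := 2) (by norm_num) (by positivity) h2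
            rw [hu, Real.logb_rpow (by norm_num) (by norm_num)] at h4
            linarith
          have h5 : ∑ j : Fin K, (if (j:ℕ) < ⌊u⌋₊ then (1:ℝ) else 0) = ⌊u⌋₊ := by
            rw [Fin.sum_univ_eq_sum_range (fun j => if j < ⌊u⌋₊ then (1:ℝ) else 0) K]
            rw [Finset.sum_ite, Finset.sum_const_zero, add_zero, Finset.sum_const, nsmul_eq_mul, mul_one]
            congr 1
            have : Finset.filter (fun j => j < ⌊u⌋₊) (Finset.range K) = Finset.range ⌊u⌋₊ := by
              ext j; simp; omega
            rw [this, Finset.card_range]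
          calc u - 1 ≤ ⌊u⌋₊ := by linarith [Nat.lt_floor_add_one u]
            _ ≤ _ := by rw [← h5]; exact Finset.sum_le_sum fun j _ => h1 j
        have h6 : (2:ℝ)^s - 1 ≤ ∑ v, ∑ j, q v * (1 - bad j v) := by
          have h7 : (2:ℝ)^s = ∑ v, q v * (2:ℝ)^(t - δ v) := by
            have : ∀ v, q v * (2:ℝ)^(t - δ v) = (2:ℝ)^t * (q v * (2:ℝ)^(-δ v)) := fun v => by
              rw [sub_eq_add_neg, Real.rpow_add (by norm_num)]; ring
            simp only [this]
            rw [← Finset.mul_sum, ← hS, ht, Real.rpow_add (by norm_num), Real.rpow_neg (by norm_num),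
              Real.rpow_logb (by norm_num) (by norm_num) hSp]
            field_simp
          calc (2:ℝ)^s - 1 = ∑ v, q v * ((2:ℝ)^(t - δ v) - 1) := by
                simp only [mul_sub, mul_one, Finset.sum_sub_distrib, hq1, ← h7]
            _ ≤ ∑ v, q v * ∑ j, (1 - bad j v) := Finset.sum_le_sum fun v _ =>
                mul_le_mul_of_nonneg_left (hcount v) (hq v)
            _ = _ := by simp only [Finset.mul_sum]
        linarith
  calc _ ≤ ∑ Y : Fin K → V, (∏ j, q (Y j)) * (t + B * ∏ j, bad j (Y j)) :=
        Finset.sum_le_sum fun Y _ => mul_le_mul_of_nonneg_left (hcost Y) (hπ0 Y)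
    _ = t + B * ∑ Y : Fin K → V, (∏ j, q (Y j)) * ∏ j, bad j (Y j) := by
        simp only [mul_add, Finset.sum_add_distrib, ← Finset.sum_mul, hπ1, Finset.mul_sum]
        rw [one_mul]; congr 1
        exact Finset.sum_congr rfl fun Y _ => by ring
    _ ≤ t + B * Real.exp (1 - (2:ℝ) ^ s) := by gcongr
    _ = _ := by ring

theorem cost_meas {Ω : Type*} [MeasurableSpace Ω] (δ : Ω → V → ℝ)
    (hδm : ∀ v, Measurable fun x => δ x v) {K : ℕ} (Y : Fin K → V) :
    Measurable fun x => ⨅ j : Fin K, (Real.logb 2 (j + 1) + δ x (Y j)) :=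
  Measurable.iInf fun j => (hδm _).const_add _

theorem cost_bd (δ : V → ℝ) (B : ℝ) (h0 : ∀ v, 0 ≤ δ v) (hB : ∀ v, δ v ≤ B)
    {K : ℕ} (hK : 0 < K) (Y : Fin K → V) :
    0 ≤ (⨅ j : Fin K, (Real.logb 2 (j + 1) + δ (Y j))) ∧
    (⨅ j : Fin K, (Real.logb 2 (j + 1) + δ (Y j))) ≤ B := by
  have : Nonempty (Fin K) := ⟨⟨0, hK⟩⟩
  constructor
  · refine le_ciInf fun j => add_nonneg (Real.logb_nonneg (by norm_num) ?_) (h0 _)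
    have : (0:ℝ) ≤ (j:ℕ) := Nat.cast_nonneg _
    linarith
  · refine (ciInf_le (Set.finite_range _).bddBelow ⟨0, hK⟩).trans ?_
    simp [hB]

theorem rc_exists {Ω : Type*} [MeasurableSpace Ω] (μ : Measure Ω) [IsProbabilityMeasure μ]
    (q : V → ℝ) (hq : ∀ v, 0 ≤ q v) (hq1 : ∑ v, q v = 1) (δ : Ω → V → ℝ)
    (hδm : ∀ v, Measurable fun x => δ x v) (B : ℝ) (hB0 : 0 ≤ B) (h0 : ∀ x v, 0 ≤ δ x v)
    (hB : ∀ x v, δ x v ≤ B) (s : ℝ) (hs : 0 ≤ s) (K : ℕ) (hK : (2:ℝ) ^ (B + s) ≤ K) :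
    ∃ Y : Fin K → V, ∫ x, (⨅ j : Fin K, (Real.logb 2 (j + 1) + δ x (Y j))) ∂μ ≤
      ∫ x, -Real.logb 2 (∑ v, q v * (2:ℝ) ^ (-δ x v)) ∂μ + s + Real.exp (1 - (2:ℝ) ^ s) * B := by
  have hK1 : (1:ℝ) ≤ K := (Real.one_le_rpow (by norm_num) (by linarith)).trans hK
  have hK0 : 0 < K := by
    rcases Nat.eq_zero_or_pos K with h | h
    · subst h; norm_num at hK1
    · exact h
  have hi : ∀ Y : Fin K → V, Integrable (fun x => ⨅ j : Fin K, (Real.logb 2 (j + 1) + δ x (Y j))) μ := by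
    intro Y
    refine Integrable.of_bound (cost_meas δ hδm Y).aestronglyMeasurable B (Eventually.of_forall fun x => ?_)
    obtain ⟨h1, h2⟩ := cost_bd (δ x) B (h0 x) (hB x) hK0 Y
    rw [Real.norm_of_nonneg h1]; exact h2
  have hZi : Integrable (fun x => -Real.logb 2 (∑ v, q v * (2:ℝ) ^ (-δ x v))) μ := by
    refine Integrable.of_bound (Measurable.aestronglyMeasurable ?_) B (Eventually.of_forall fun x => ?_)
    · have : Measurable fun x => ∑ v, q v * (2:ℝ) ^ (-δ x v) :=
        Finset.measurable_sum _ fun v _ => ((hδm v).neg.const_pow 2).const_mul _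
      exact ((Real.measurable_log.comp this).div_const _).neg
    · obtain ⟨h1, h2⟩ := Z_bounds q (δ x) hq hq1 B (h0 x) (hB x)
      rw [Real.norm_of_nonneg h1]; exact h2
  set R := ∫ x, -Real.logb 2 (∑ v, q v * (2:ℝ) ^ (-δ x v)) ∂μ + s + Real.exp (1 - (2:ℝ) ^ s) * B with hR
  by_contra hcon
  push Not at hcon
  have hπ0 : ∀ Y : Fin K → V, 0 ≤ ∏ j, q (Y j) := fun Y => Finset.prod_nonneg fun j _ => hq _
  have hπ1 : ∑ Y : Fin K → V, ∏ j, q (Y j) = 1 := by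
    have := Finset.prod_univ_sum (fun _ : Fin K => (Finset.univ : Finset V)) (fun _ => q)
    rw [Fintype.piFinset_univ] at this
    rw [← this]; simp [hq1]
  have hup : ∑ Y : Fin K → V, (∏ j, q (Y j)) * ∫ x, (⨅ j : Fin K, (Real.logb 2 (j + 1) + δ x (Y j))) ∂μ ≤ R := by
    calc _ = ∫ x, ∑ Y : Fin K → V, (∏ j, q (Y j)) * (⨅ j : Fin K, (Real.logb 2 (j + 1) + δ x (Y j))) ∂μ := by
          rw [integral_finset_sum _ fun Y _ => (hi Y).const_mul _]
          simp only [integral_const_mul]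
      _ ≤ ∫ x, (-Real.logb 2 (∑ v, q v * (2:ℝ) ^ (-δ x v)) + (s + Real.exp (1 - (2:ℝ) ^ s) * B)) ∂μ := by
          refine integral_mono (integrable_finset_sum _ fun Y _ => (hi Y).const_mul _)
            (hZi.add (integrable_const _)) fun x => ?_
          have := rc_one q (δ x) hq hq1 B (h0 x) (hB x) s hs K hK
          simp only
          linarith
      _ = R := by
          rw [integral_add hZi (integrable_const _)]
          simp [hR]; ring
  have hex : ∃ Y : Fin K → V, 0 < ∏ j, q (Y j) := by
    by_contra h
    push Not at h
    have : ∑ Y : Fin K → V, ∏ j, q (Y j) ≤ 0 := Finset.sum_nonpos fun Y _ => h Y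
    linarith
  obtain ⟨Y0, hY0⟩ := hex
  have : R < ∑ Y : Fin K → V, (∏ j, q (Y j)) * ∫ x, (⨅ j : Fin K, (Real.logb 2 (j + 1) + δ x (Y j))) ∂μ := by
    calc R = ∑ Y : Fin K → V, (∏ j, q (Y j)) * R := by rw [← Finset.sum_mul, hπ1, one_mul]
      _ < _ := Finset.sum_lt_sum (fun Y _ => mul_le_mul_of_nonneg_left (hcon Y).le (hπ0 Y))
        ⟨Y0, Finset.mem_univ _, mul_lt_mul_of_pos_left (hcon Y0) hY0⟩
  linarith
end rc
end EFS

namespace EFS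
section val
variable {X A : Type*} [Fintype X] [DecidableEq X] [MeasurableSpace X] [DiscreteMeasurableSpace X]
  [Fintype A] [DecidableEq A] [Nonempty A]
  (μ : Measure (ℕ → X)) [IsProbabilityMeasure μ] (d : X → A → ℝ) (α : ℝ)

theorem exists_value (hα : 0 < α) (c : ℝ)
    (hc : (⨅ (D : ℝ) (_ : 0 ≤ D), RDfun (Xh := A) μ d D + ((α * D : ℝ) : EReal)) < (c : EReal)) :
    ∃ n : ℕ, 1 ≤ n ∧ ∃ ν : (Fin n → X) × (Fin n → A) → ℝ, (∀ p, 0 ≤ ν p) ∧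
      (∀ w : Fin n → X, ∑ y : Fin n → A, ν (w, y) =
        (μ {x : ℕ → X | ∀ i : Fin n, x i.val = w i}).toReal) ∧
      mutualInfo ν / n + α * ∑ p, ν p * avgDist d n p.1 p.2 < c := by
  simp only [iInf_lt_iff] at hc
  obtain ⟨D, hD, h⟩ := hc
  have h1 : RDfun (Xh := A) μ d D < ((c - α * D : ℝ) : EReal) := by
    rw [EReal.coe_sub]
    exact EReal.lt_sub_iff_add_lt (Or.inl (EReal.coe_ne_bot _)) (Or.inl (EReal.coe_ne_top _)) |>.2 h
  unfold RDfun at h1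
  rw [iInf_lt_iff] at h1
  obtain ⟨⟨n, hn⟩, h2⟩ := h1
  unfold RDn at h2
  rw [sInf_lt_iff] at h2
  obtain ⟨r, ⟨ν, h0, -, hm, hD', rfl⟩, h3⟩ := h2
  refine ⟨n, hn, ν, h0, hm, ?_⟩
  have h4 := EReal.coe_lt_coe_iff.1 h3
  have h5 := mul_le_mul_of_nonneg_left hD' hα.le
  simp only at h4 h5 ⊢
  linarith

theorem Z_le (hα : 0 < α) (hd : ∀ a b, 0 ≤ d a b) {n : ℕ} (hn : 1 ≤ n)
    (ν : (Fin n → X) × (Fin n → A) → ℝ) (h0 : ∀ p, 0 ≤ ν p)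
    (hm : ∀ w : Fin n → X, ∑ y : Fin n → A, ν (w, y) =
        (μ {x : ℕ → X | ∀ i : Fin n, x i.val = w i}).toReal) :
    ∫ x, -Real.logb 2 (∑ y : Fin n → A, (∑ w, ν (w, y)) * (2:ℝ) ^ (-dl d α x (List.ofFn y))) ∂μ ≤
      mutualInfo ν + n * (α * ∑ p, ν p * avgDist d n p.1 p.2) := by
  set P : (Fin n → X) → ℝ := fun w => (μ {x : ℕ → X | ∀ i : Fin n, x i.val = w i}).toReal with hP
  set q : (Fin n → A) → ℝ := fun y => ∑ w, ν (w, y) with hq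
  let δ : (Fin n → X) → (Fin n → A) → ℝ := fun w y => n * (α * avgDist d n w y)
  let S : (Fin n → X) → ℝ := fun w => ∑ y, q y * (2:ℝ) ^ (-δ w y)
  have e0 : ∀ x : ℕ → X, -Real.logb 2 (∑ y : Fin n → A, (∑ w, ν (w, y)) * (2:ℝ) ^ (-dl d α x (List.ofFn y))) =
      (fun w => -Real.logb 2 (S w)) (fun i : Fin n => x i) := by
    intro x
    simp only [S, δ, dl_avg d α hn, hq]
  simp only [e0]
  rw [int_cyl μ n (fun w => -Real.logb 2 (S w))]
  have hP0 : ∀ w, 0 ≤ P w := fun w => ENNReal.toReal_nonneg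
  have hq0 : ∀ y, 0 ≤ q y := fun y => Finset.sum_nonneg fun w _ => h0 _
  have hqs : ∑ y, q y = 1 := by
    simp only [hq]; rw [Finset.sum_comm]; simp only [hm]; exact sum_cyl μ n
  have hS : ∀ w, 0 < S w := by
    intro w
    refine lt_of_lt_of_le ?_ (S_bounds q (δ w) hq0 hqs (∑ y, δ w y) ?_ ?_).1
    · positivity
    · intro y
      simp only [δ]
      have : 0 ≤ avgDist d n w y := div_nonneg (Finset.sum_nonneg fun i _ => hd _ _) (by positivity)
      positivity
    · intro y
      refine Finset.single_le_sum (f := fun y => δ w y) (fun y _ => ?_) (Finset.mem_univ y)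
      simp only [δ]
      have : 0 ≤ avgDist d n w y := div_nonneg (Finset.sum_nonneg fun i _ => hd _ _) (by positivity)
      positivity
  have hνP : ∀ w y, 0 < ν (w, y) → 0 < P w := fun w y h =>
    h.trans_le ((Finset.single_le_sum (f := fun y => ν (w, y)) (fun y _ => h0 _) (Finset.mem_univ y)).trans (hm w).le)
  have hνq : ∀ w y, 0 < ν (w, y) → 0 < q y := fun w y h =>
    h.trans_le (Finset.single_le_sum (f := fun w => ν (w, y)) (fun y _ => h0 _) (Finset.mem_univ w))
  let τ : (Fin n → X) × (Fin n → A) → ℝ := fun p => P p.1 * (q p.2 * (2:ℝ)^(-δ p.1 p.2)) / S p.1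
  have hsumν : ∀ g : (Fin n → X) → ℝ, ∑ p : (Fin n → X) × (Fin n → A), ν p * g p.1 = ∑ w, P w * g w := by
    intro g
    rw [Fintype.sum_prod_type]
    refine Finset.sum_congr rfl fun w _ => ?_
    change ∑ y, ν (w, y) * g w = _
    rw [← Finset.sum_mul, hm]
  have hsumν2 : ∀ g : (Fin n → A) → ℝ, ∑ p : (Fin n → X) × (Fin n → A), ν p * g p.2 = ∑ w, q w * g w := by
    intro g
    rw [Fintype.sum_prod_type, Finset.sum_comm]
    refine Finset.sum_congr rfl fun w _ => ?_
    change ∑ y, ν (y, w) * g w = _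
    rw [← Finset.sum_mul]
  have hg := gibbs Finset.univ ν τ (fun p _ => h0 p)
    (fun p _ => div_nonneg (mul_nonneg (hP0 _) (mul_nonneg (hq0 _) (by positivity))) (hS _).le)
    (fun p _ h => div_pos (mul_pos (hνP _ _ h) (mul_pos (hνq _ _ h) (by positivity))) (hS _)) (by
      have e1 : ∑ p, τ p = ∑ w, P w := by
        rw [Fintype.sum_prod_type]
        refine Finset.sum_congr rfl fun w _ => ?_
        simp only [τ]
        rw [← Finset.sum_div, ← Finset.mul_sum]
        exact mul_div_cancel_right₀ _ (hS w).ne'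
      have e2 := hsumν (fun _ => 1)
      simp only [mul_one] at e2
      rw [e1, e2])
  have e3 : ∑ p, ν p * Real.logb 2 (τ p) = ∑ p, ν p * Real.logb 2 (P p.1) + ∑ p, ν p * Real.logb 2 (q p.2)
      - ∑ p, ν p * δ p.1 p.2 + ∑ p : (Fin n → X) × (Fin n → A), ν p * -Real.logb 2 (S p.1) := by
    rw [← Finset.sum_add_distrib, ← Finset.sum_sub_distrib, ← Finset.sum_add_distrib]
    refine Finset.sum_congr rfl fun p _ => ?_
    rcases (h0 p).eq_or_lt with h | h
    · simp [← h]
    · have a1 := hνP p.1 p.2 h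
      have a2 := hνq p.1 p.2 h
      have a3 : (0:ℝ) < (2:ℝ)^(-δ p.1 p.2) := by positivity
      simp only [τ]
      rw [Real.logb_div (by positivity) (hS _).ne', Real.logb_mul a1.ne' (by positivity),
        Real.logb_mul a2.ne' a3.ne', Real.logb_rpow (by norm_num) (by norm_num)]
      ring
  have e4 : ∑ p, ν p * δ p.1 p.2 = n * (α * ∑ p, ν p * avgDist d n p.1 p.2) := by
    simp only [δ, Finset.mul_sum]
    exact Finset.sum_congr rfl fun p _ => by ring
  rw [hsumν (fun w => Real.logb 2 (P w)), hsumν2 (fun w => Real.logb 2 (q w)),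
    hsumν (fun w => -Real.logb 2 (S w)), e4] at e3
  have e5 : mutualInfo ν = -∑ w, P w * Real.logb 2 (P w) + -∑ w, q w * Real.logb 2 (q w)
      + ∑ p, ν p * Real.logb 2 (ν p) := by
    unfold mutualInfo shannonEntropy
    simp only [hm, hq, hP]; ring
  rw [e5]
  linarith

/-- block product weight -/
noncomputable def qp (q : List A → ℝ) (N : ℕ) : ℕ → List A → ℝ
  | 0, _ => 1
  | J + 1, l => q (l.take N) * qp q N J (l.drop N)

variable (q : List A → ℝ) (N : ℕ)

theorem qp_nonneg (hq : ∀ l, 0 ≤ q l) (J : ℕ) (l : List A) : 0 ≤ qp q N J l := by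
  induction J generalizing l with
  | zero => simp [qp]
  | succ J ih => exact mul_nonneg (hq _) (ih _)

theorem qp_append (J : ℕ) (u w : List A) (hu : u.length = N) : qp q N (J + 1) (u ++ w) = q u * qp q N J w := by
  simp [qp, ← hu]

theorem qp_sum (hq1 : sumL N q = 1) (J : ℕ) : sumL (N * J) (qp q N J) = 1 := by
  induction J with
  | zero => rw [mul_zero, sumL_zero]; rfl
  | succ J ih =>
    rw [show N * (J + 1) = N + N * J by ring, sumL_add]
    rw [sumL_congr (g := fun u => q u * 1)]
    · simp [hq1]
    · intro u hu
      rw [← ih, ← sumL_mul_left]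
      exact sumL_congr fun w _ => qp_append q N J u w hu

theorem qp_S (J : ℕ) (x : ℕ → X) :
    sumL (N * (J + 1)) (fun l => qp q N (J + 1) l * (2:ℝ) ^ (-dl d α x l)) =
      sumL N (fun l => q l * (2:ℝ) ^ (-dl d α x l)) *
      sumL (N * J) (fun l => qp q N J l * (2:ℝ) ^ (-dl d α (shift^[N] x) l)) := by
  rw [show N * (J + 1) = N + N * J by ring, sumL_add, ← sumL_mul_right]
  refine sumL_congr fun u hu => ?_
  rw [← sumL_mul_left]
  refine sumL_congr fun w _ => ?_
  rw [qp_append q N J u w hu, dl_append, hu, neg_add, Real.rpow_add (by norm_num)]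
  ring

theorem S_meas (n : ℕ) (q : List A → ℝ) :
    Measurable fun x : ℕ → X => -Real.logb 2 (sumL n (fun l => q l * (2:ℝ) ^ (-dl d α x l))) := by
  have : Measurable fun x : ℕ → X => sumL n (fun l => q l * (2:ℝ) ^ (-dl d α x l)) :=
    Finset.measurable_sum _ fun v _ => ((dl_measurable d α _).neg.const_pow 2).const_mul _
  exact ((Real.measurable_log.comp this).div_const _).neg

theorem qp_Z (hT : Ergodic (shift : (ℕ → X) → ℕ → X) μ) (hα : 0 < α) (hd : ∀ a b, 0 ≤ d a b)
    (C : ℝ) (hC : ∀ a b, α * d a b ≤ C) (hq : ∀ l, 0 ≤ q l) (hq1 : sumL N q = 1) (J : ℕ) :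
    ∫ x, -Real.logb 2 (sumL (N * J) (fun l => qp q N J l * (2:ℝ) ^ (-dl d α x l))) ∂μ =
      J * ∫ x, -Real.logb 2 (sumL N (fun l => q l * (2:ℝ) ^ (-dl d α x l))) ∂μ := by
  have hb : ∀ (n : ℕ) (q : List A → ℝ) (hq : ∀ l, 0 ≤ q l) (hq1 : sumL n q = 1) (x : ℕ → X),
      0 < sumL n (fun l => q l * (2:ℝ) ^ (-dl d α x l)) := by
    intro n q hq hq1 x
    refine lt_of_lt_of_le ?_ (S_bounds (fun v : Fin n → A => q (List.ofFn v))
      (fun v : Fin n → A => dl d α x (List.ofFn v)) (fun v => hq _) hq1 (C * n)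
      (fun v => dl_nonneg d α hα.le hd x _) (fun v => by
        have := dl_le d α C hC x (List.ofFn v)
        simpa using this)).1
    positivity
  have hi : ∀ (n : ℕ) (q : List A → ℝ) (hq : ∀ l, 0 ≤ q l) (hq1 : sumL n q = 1),
      Integrable (fun x => -Real.logb 2 (sumL n (fun l => q l * (2:ℝ) ^ (-dl d α x l)))) μ := by
    intro n q hq hq1
    refine Integrable.of_bound (S_meas d α n q).aestronglyMeasurable (C * n) (Eventually.of_forall fun x => ?_)
    obtain ⟨h1, h2⟩ := Z_bounds (fun v : Fin n → A => q (List.ofFn v))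
      (fun v : Fin n → A => dl d α x (List.ofFn v)) (fun v => hq _) hq1 (C * n)
      (fun v => dl_nonneg d α hα.le hd x _) (fun v => by
        have := dl_le d α C hC x (List.ofFn v)
        simpa using this)
    rw [Real.norm_of_nonneg (by exact h1)]
    exact h2
  induction J with
  | zero => simp [sumL_zero, qp, dl]
  | succ J ih =>
    have hmp := hT.toMeasurePreserving.iterate N
    have hiJ := hi (N * J) (qp q N J) (qp_nonneg q N hq J) (qp_sum q N hq1 J)
    have hcomp : ∫ x, -Real.logb 2 (sumL (N * J) (fun l => qp q N J l * (2:ℝ) ^ (-dl d α (shift^[N] x) l))) ∂μ =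
        ∫ x, -Real.logb 2 (sumL (N * J) (fun l => qp q N J l * (2:ℝ) ^ (-dl d α x l))) ∂μ := by
      conv_rhs => rw [← hmp.map_eq]
      rw [integral_map hmp.measurable.aemeasurable (S_meas d α _ _).aestronglyMeasurable]
    have hstep : ∀ x, -Real.logb 2 (sumL (N * (J + 1)) (fun l => qp q N (J + 1) l * (2:ℝ) ^ (-dl d α x l))) =
        -Real.logb 2 (sumL N (fun l => q l * (2:ℝ) ^ (-dl d α x l))) +
        -Real.logb 2 (sumL (N * J) (fun l => qp q N J l * (2:ℝ) ^ (-dl d α (shift^[N] x) l))) := by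
      intro x
      rw [qp_S, Real.logb_mul (hb N q hq hq1 x).ne'
        (hb (N * J) (qp q N J) (qp_nonneg q N hq J) (qp_sum q N hq1 J) _).ne']
      ring
    simp only [hstep]
    rw [integral_add (hi N q hq hq1) (by exact hmp.integrable_comp_of_integrable hiJ), hcomp, ih]
    push_cast; ring
end val

theorem overhead (ε C : ℝ) (hε : 0 < ε) (hC : 0 ≤ C) : ∀ᶠ M : ℕ in atTop,
    Real.exp (1 - (2:ℝ) ^ (ε * M)) * (C * M) + Real.logb 2 (3 + (C + ε) * M) + 1 ≤ ε * M := by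
  have hl2 : 0 < Real.log 2 := Real.log_pos (by norm_num)
  have hnat := tendsto_natCast_atTop_atTop (R := ℝ)
  have h1 : Tendsto (fun M : ℕ => Real.exp (1 - (2:ℝ) ^ (ε * M)) * C) atTop (nhds 0) := by
    have a1 : Tendsto (fun M : ℕ => (2:ℝ) ^ (ε * M)) atTop atTop := by
      have : Tendsto (fun M : ℕ => Real.exp (Real.log 2 * (ε * M))) atTop atTop :=
        Real.tendsto_exp_atTop.comp ((hnat.const_mul_atTop hε).const_mul_atTop hl2)
      refine this.congr fun M => ?_
      rw [Real.rpow_def_of_pos (by norm_num)]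
    have a2 : Tendsto (fun M : ℕ => 1 - (2:ℝ) ^ (ε * M)) atTop atBot :=
      tendsto_atBot_add_const_left _ 1 (tendsto_neg_atTop_atBot.comp a1)
    simpa using (Real.tendsto_exp_atBot.comp a2).mul_const C
  have h2 := h1.eventually (gt_mem_nhds (show (0:ℝ) < ε / 4 by positivity))
  have h3 := hnat.eventually (Real.isLittleO_log_id_atTop.def (show (0:ℝ) < ε / 4 * Real.log 2 by positivity))
  have h4 := hnat.eventually (eventually_ge_atTop ((Real.log (3 + (C + ε)) / Real.log 2 + 1) * (2 / ε)))
  filter_upwards [h2, h3, h4, eventually_ge_atTop 1] with M h2 h3 h4 hM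
  have hM1 : (1:ℝ) ≤ M := by exact_mod_cast hM
  have hM0 : (0:ℝ) < M := by linarith
  simp only [id, Real.norm_eq_abs] at h3
  rw [abs_of_pos hM0] at h3
  have h3' := (le_abs_self _).trans h3
  have h5 : Real.logb 2 (3 + (C + ε) * M) ≤ Real.log (3 + (C + ε)) / Real.log 2 + ε / 4 * M := by
    unfold Real.logb
    have : Real.log (3 + (C + ε) * M) ≤ Real.log ((3 + (C + ε)) * M) :=
      Real.log_le_log (by positivity) (by nlinarith)
    rw [Real.log_mul (by positivity) (by positivity)] at this
    rw [div_add' _ _ _ hl2.ne']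
    gcongr
    linarith
  have h6 : (Real.log (3 + (C + ε)) / Real.log 2 + 1) ≤ ε / 2 * M := by
    rw [mul_div_assoc', div_le_iff₀ hε] at h4
    linarith
  nlinarith

theorem code_exists {X A : Type*} [Fintype X] [DecidableEq X] [MeasurableSpace X] [DiscreteMeasurableSpace X]
    [Fintype A] [DecidableEq A] [Nonempty A]
    (μ : Measure (ℕ → X)) [IsProbabilityMeasure μ] (hT : Ergodic (shift : (ℕ → X) → ℕ → X) μ)
    (d : X → A → ℝ) (α : ℝ) (hα : 0 < α) (hd : ∀ a b, 0 ≤ d a b)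
    (C : ℝ) (hC0 : 0 ≤ C) (hC : ∀ a b, α * d a b ≤ C) (c : ℝ)
    (hc : (⨅ (D : ℝ) (_ : 0 ≤ D), RDfun (Xh := A) μ d D + ((α * D : ℝ) : EReal)) < (c : EReal)) :
    ∃ M K : ℕ, 1 ≤ M ∧ 1 ≤ K ∧ ∃ Y : Fin K → Fin M → A,
      ∫ x, (⨅ j : Fin K, (Real.logb 2 (j + 1) + dl d α x (List.ofFn (Y j)))) ∂μ +
        Real.logb 2 (1 + Real.log K) + 1 < M * c := by
  obtain ⟨N, hN, ν, h0, hm, hv⟩ := exists_value μ d α hα c hc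
  set v0 := mutualInfo ν / N + α * ∑ p, ν p * avgDist d N p.1 p.2 with hv0
  have hN0 : (0:ℝ) < N := by exact_mod_cast hN
  set ε := (c - v0) / 3 with hε
  have hε0 : 0 < ε := by rw [hε]; linarith
  -- the list weight
  let q : List A → ℝ := fun l => ∑ y : Fin N → A, if List.ofFn y = l then ∑ w, ν (w, y) else 0
  have hqy : ∀ y : Fin N → A, q (List.ofFn y) = ∑ w, ν (w, y) := by
    intro y
    simp only [q]
    rw [Finset.sum_eq_single y]
    · simp
    · intro z _ hz
      rw [if_neg]
      exact fun h => hz (List.ofFn_injective h)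
    · simp
  have hq : ∀ l, 0 ≤ q l := fun l => Finset.sum_nonneg fun y _ => by
    split_ifs
    · exact Finset.sum_nonneg fun w _ => h0 _
    · exact le_rfl
  have hq1 : sumL N q = 1 := by
    unfold sumL
    simp only [hqy]
    rw [Finset.sum_comm]; simp only [hm]; exact sum_cyl μ N
  have hZ : ∫ x, -Real.logb 2 (sumL N (fun l => q l * (2:ℝ) ^ (-dl d α x l))) ∂μ ≤ N * v0 := by
    unfold sumL
    simp only [hqy]
    refine (Z_le μ d α hα hd hN ν h0 hm).trans (le_of_eq ?_)
    rw [hv0]; field_simp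
  obtain ⟨M0, hM0⟩ := eventually_atTop.1 (overhead ε C hε0 hC0)
  set J := M0 + 1 with hJ
  set M := N * J with hMdef
  have hMM : M0 ≤ M := by
    rw [hMdef, hJ]; nlinarith
  have hM1 : 1 ≤ M := Nat.mul_pos hN (by omega)
  have hM1' : (1:ℝ) ≤ M := by exact_mod_cast hM1
  have hov := hM0 M hMM
  set B := C * M with hB
  have hB0 : 0 ≤ B := by positivity
  set s := ε * M with hs
  have hs0 : 0 ≤ s := by positivity
  set K := ⌈(2:ℝ) ^ (B + s)⌉₊ with hK
  have hK1 : (2:ℝ) ^ (B + s) ≤ K := Nat.le_ceil _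
  have hp1 : (1:ℝ) ≤ (2:ℝ) ^ (B + s) := Real.one_le_rpow (by norm_num) (by linarith)
  have hKpos : 1 ≤ K := by
    have : (1:ℝ) ≤ K := hp1.trans hK1
    exact_mod_cast this
  have hKup : (K:ℝ) ≤ 2 * (2:ℝ) ^ (B + s) := by
    have := (Nat.ceil_lt_add_one (show (0:ℝ) ≤ (2:ℝ) ^ (B + s) by positivity)).le
    linarith
  have hlogK : Real.log K ≤ 1 + (B + s) := by
    have h1 := Real.log_le_log (by positivity) hKup
    rw [Real.log_mul (by norm_num) (by positivity), Real.log_rpow (by norm_num)] at h1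
    have h2 : Real.log 2 ≤ 1 := by linarith [Real.log_two_lt_d9]
    nlinarith
  have hlogK0 : 0 ≤ Real.log K := Real.log_nonneg (hp1.trans hK1)
  obtain ⟨Y, hY⟩ := rc_exists μ (fun v : Fin M → A => qp q N J (List.ofFn v)) (fun v => qp_nonneg q N hq J _)
    (qp_sum q N hq1 J) (fun x v => dl d α x (List.ofFn v)) (fun v => dl_measurable d α _) B hB0
    (fun x v => dl_nonneg d α hα.le hd x _) (fun x v => by
        have := dl_le d α C hC x (List.ofFn v)
        simpa using this) s hs0 K hK1
  refine ⟨M, K, hM1, hKpos, Y, ?_⟩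
  have hZM := qp_Z μ d α q N hT hα hd C hC hq hq1 J
  have hZM' : ∫ x, -Real.logb 2 (∑ v : Fin M → A, qp q N J (List.ofFn v) * (2:ℝ) ^ (-dl d α x (List.ofFn v))) ∂μ ≤ M * v0 := by
    have : (M:ℝ) * v0 = J * (N * v0) := by rw [hMdef]; push_cast; ring
    rw [this]
    refine (le_of_eq hZM).trans ?_
    exact mul_le_mul_of_nonneg_left hZ (by positivity)
  have hlog2 : Real.logb 2 (1 + Real.log K) ≤ Real.logb 2 (3 + (C + ε) * M) := by
    refine Real.logb_le_logb_of_le (by norm_num) (by linarith) ?_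
    have : (C + ε) * M = B + s := by rw [hB, hs]; ring
    linarith
  have hcε : M * c = M * v0 + 3 * s := by rw [hs, hε]; ring
  have hspos : 0 < s := by positivity
  linarith
end EFS

namespace EFS

theorem greedy_A (h : ℕ → ℕ → ℝ) (C : ℝ) (hC0 : 0 ≤ C) (hC : ∀ i K, h i K ≤ C * K)
    (hsub : ∀ i a b, h i (a + b) ≤ h i a + h (i + a) b) (e : ℕ → ℝ) (he : ∀ p, 0 ≤ e p)
    (s M : ℕ) (hM : 1 ≤ M) (hb : ∀ b, h (s + b * M) M ≤ e (s + b * M)) (K : ℕ) :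
    ∀ b, h (s + b * M) K ≤ C * M + ∑ t ∈ Finset.range K, e (s + b * M + t) := by
  induction K using Nat.strong_induction_on with
  | _ K ih =>
    intro b
    by_cases hK : K < M
    · have h1 : C * K ≤ C * M := mul_le_mul_of_nonneg_left (by exact_mod_cast hK.le) hC0
      have h2 : 0 ≤ ∑ t ∈ Finset.range K, e (s + b * M + t) := Finset.sum_nonneg fun t _ => he _
      linarith [hC (s + b * M) K]
    · obtain ⟨K', rfl⟩ := Nat.exists_eq_add_of_le (not_lt.1 hK)
      have h1 := hsub (s + b * M) M K'
      have h2 := ih K' (by omega) (b + 1)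
      rw [show s + (b + 1) * M = s + b * M + M by ring] at h2
      have h3 : e (s + b * M) ≤ ∑ t ∈ Finset.range M, e (s + b * M + t) :=
        Finset.single_le_sum (f := fun t => e (s + b * M + t)) (fun t _ => he _)
          (Finset.mem_range.2 (show 0 < M by omega))
      rw [Finset.sum_range_add]
      simp only [← add_assoc]
      linarith [hb b]

theorem greedy_B (h : ℕ → ℕ → ℝ) (C : ℝ) (hC0 : 0 ≤ C) (hC : ∀ i K, h i K ≤ C * K)
    (hsub : ∀ i a b, h i (a + b) ≤ h i a + h (i + a) b) (e : ℕ → ℝ) (he : ∀ p, 0 ≤ e p)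
    (s M : ℕ) (hM : 1 ≤ M) (hs : s < M) (hb : ∀ b, h (s + b * M) M ≤ e (s + b * M)) (i K : ℕ) :
    h i K ≤ 2 * M * C + ∑ t ∈ Finset.range K, e (i + t) := by
  have hex : ∃ a b, a ≤ M ∧ i + a = s + b * M := by
    by_cases hi : i ≤ s
    · exact ⟨s - i, 0, by omega, by omega⟩
    · refine ⟨M - (i - s) % M, (i - s) / M + 1, by omega, ?_⟩
      have h1 := Nat.div_add_mod (i - s) M
      have h2 := Nat.mod_lt (i - s) (show 0 < M by omega)
      have h3 : ((i - s) / M + 1) * M = M * ((i - s) / M) + M := by ring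
      omega
  obtain ⟨a, b, ha, hab⟩ := hex
  have hMC : 0 ≤ C * M := by positivity
  by_cases hK : K ≤ a
  · have h1 : C * K ≤ C * M := mul_le_mul_of_nonneg_left (by exact_mod_cast hK.trans ha) hC0
    have h2 : 0 ≤ ∑ t ∈ Finset.range K, e (i + t) := Finset.sum_nonneg fun t _ => he _
    linarith [hC i K]
  · obtain ⟨K', rfl⟩ := Nat.exists_eq_add_of_le (not_le.1 hK).le
    have h1 := hsub i a K'
    have h2 := greedy_A h C hC0 hC hsub e he s M hM hb K' b
    have h3 : C * a ≤ C * M := mul_le_mul_of_nonneg_left (by exact_mod_cast ha) hC0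
    have h4 : 0 ≤ ∑ t ∈ Finset.range a, e (i + t) := Finset.sum_nonneg fun t _ => he _
    rw [Finset.sum_range_add]
    simp only [← add_assoc]
    rw [← hab] at h2
    linarith [hC i a]

section
variable {X A : Type*} [Fintype A] [DecidableEq A] [Nonempty A]

theorem Q_exists {M K : ℕ} (hM : 1 ≤ M) (hK : 1 ≤ K) (Y : Fin K → Fin M → A) :
    ∃ Q : List A → ℝ, (∀ l, 0 < Q l) ∧ Q [] = 1 ∧ (∀ u w, Q u * Q w ≤ Q (u ++ w)) ∧
      (∀ n, sumL n Q ≤ 1) ∧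
      ∀ j : Fin K, -Real.logb 2 (Q (List.ofFn (Y j))) ≤
        Real.logb 2 (j + 1) + (Real.logb 2 (1 + Real.log K) + 1) := by
  have hK' : (1:ℝ) ≤ K := by exact_mod_cast hK
  set lam := 1 + Real.log K with hlam
  have hlam1 : 0 < lam := by have := Real.log_nonneg hK'; linarith
  let w : Fin K → ℝ := fun j => 1 / (((j:ℕ) + 1) * lam)
  have hw : ∀ j, 0 < w j := fun j => by simp only [w]; positivity
  have hwsum : ∑ j, w j ≤ 1 := by
    have h1 := harmonic_le_one_add_log K
    have h2 : ∑ j, w j = (harmonic K : ℝ) / lam := by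
      refine (Fin.sum_univ_eq_sum_range (fun j => 1 / ((((j:ℕ):ℝ) + 1) * lam)) K).trans ?_
      unfold harmonic
      push_cast
      rw [Finset.sum_div]
      refine Finset.sum_congr rfl fun j _ => ?_
      have : ((j:ℝ) + 1) ≠ 0 := by positivity
      field_simp
    rw [h2, div_le_one hlam1]
    exact h1
  let W : List A → ℝ := fun l => ∑ j, if List.ofFn (Y j) = l then w j else 0
  have hW0 : ∀ l, 0 ≤ W l := fun l => Finset.sum_nonneg fun j _ => by
    split_ifs
    · exact (hw j).le
    · exact le_rfl
  have hWj : ∀ j, w j ≤ W (List.ofFn (Y j)) := fun j => by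
    have := Finset.single_le_sum (f := fun i => if List.ofFn (Y i) = List.ofFn (Y j) then w i else 0)
      (s := Finset.univ) (fun i _ => by
        split_ifs
        · exact (hw i).le
        · exact le_rfl) (Finset.mem_univ j)
    simpa [W] using this
  have hWs : sumL M W ≤ 1 := by
    refine le_trans (le_of_eq ?_) hwsum
    unfold sumL
    simp only [W]
    rw [Finset.sum_comm]
    refine Finset.sum_congr rfl fun j _ => ?_
    simp [List.ofFn_inj]
  have hcA : (0:ℝ) < Fintype.card A := by exact_mod_cast Fintype.card_pos
  let v : List A → ℝ := fun l => (if l.length = M then W l / 2 else 0) +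
    (if l.length = 1 then 1 / (2 * (Fintype.card A : ℝ)) else 0)
  have hv : ∀ l, 0 ≤ v l := fun l => by
    have := hW0 l
    simp only [v]
    split_ifs <;> positivity
  have hv1 : ∀ a, 0 < v [a] := fun a => by
    have := hW0 [a]
    simp only [v, List.length_singleton, if_true]
    split_ifs <;> positivity
  have hsum : ∀ m, sumL (m + 1) v ≤ (if m = M - 1 then (1/2:ℝ) else 0) + (if m = 0 then (1/2:ℝ) else 0) := by
    intro m
    have e : sumL (m + 1) v = sumL (m+1) (fun l => if l.length = M then W l / 2 else 0) +
        sumL (m+1) (fun l : List A => if l.length = 1 then 1 / (2 * (Fintype.card A : ℝ)) else 0) := by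
      exact Finset.sum_add_distrib
    rw [e]
    refine add_le_add ?_ ?_
    · by_cases h : m = M - 1
      · have h' : m + 1 = M := by omega
        rw [if_pos h, h', sumL_congr (g := fun l => W l * (1/2))]
        · rw [sumL_mul_right]; linarith
        · intro l hl; rw [if_pos hl]; ring
      · have h' : m + 1 ≠ M := by omega
        rw [if_neg h, sumL_congr (g := fun l => 0 * W l)]
        · rw [sumL_mul_left]; simp
        · intro l hl; rw [if_neg (by omega)]; ring
    · by_cases h : m = 0
      · subst h
        unfold sumL
        simp
      · rw [if_neg h, sumL_congr (g := fun l => 0 * W l)]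
        · rw [sumL_mul_left]; simp
        · intro l hl; rw [if_neg (by omega)]; ring
  refine ⟨ren v, ren_pos hv hv1, ren_nil, fun u w => ren_append hv w _ u rfl, ren_kraft hv _ hsum ?_, ?_⟩
  · intro n
    rw [Finset.sum_add_distrib, Finset.sum_ite_eq', Finset.sum_ite_eq']
    split_ifs <;> norm_num
  · intro j
    have h1 : v (List.ofFn (Y j)) ≤ ren v (List.ofFn (Y j)) := le_ren hv (by
      intro h; have := congrArg List.length h; simp at this; omega)
    have h2 : w j / 2 ≤ v (List.ofFn (Y j)) := by
      simp only [v, List.length_ofFn, if_true]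
      have := hWj j
      have h3 : (0:ℝ) ≤ if M = 1 then 1 / (2 * (Fintype.card A : ℝ)) else 0 := by split_ifs <;> positivity
      linarith
    have h3 := Real.logb_le_logb_of_le (b := 2) (by norm_num) (half_pos (hw j)) (h2.trans h1)
    rw [Real.logb_div (hw j).ne' (by norm_num), Real.logb_self_eq_one (by norm_num)] at h3
    simp only [w] at h3
    rw [Real.logb_div (by norm_num) (by positivity), Real.logb_one, Real.logb_mul (by positivity) hlam1.ne'] at h3
    linarith

end
end EFS

namespace EFS
section det
variable {X A : Type*} [Fintype A] [DecidableEq A] [Nonempty A]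

/-- deterministic entropy estimate for a blockwise parsed sequence -/
theorem ent_block {n : ℕ} (hn : 0 < n) (z : ℕ → A) (Q : List A → ℝ) (hQ : ∀ l, 0 < Q l) (hnil : Q [] = 1)
    (hmul : ∀ u w, Q u * Q w ≤ Q (u ++ w)) (hQ1 : ∀ n, sumL n Q ≤ 1)
    (C : ℝ) (hC0 : 0 ≤ C) (hC : ∀ a, -Real.logb 2 (Q [a]) ≤ C)
    (e : ℕ → ℝ) (he : ∀ p, 0 ≤ e p) (s M : ℕ) (hM : 1 ≤ M) (hs : s < M)
    (hb : ∀ b, -Real.logb 2 (Q (win z (s + b * M) M)) ≤ e (s + b * M)) (L k : ℕ) (hL : 1 ≤ L) (hk : L ≤ k + 1) :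
    n * condEmpEntropy n k (fun i : Fin n => z i) ≤
      2 * M * C * n / L + C * L + ∑ p ∈ Finset.range n, e p := by
  set y : Fin n → A := fun i => z i with hy
  have hL0 : (0:ℝ) < L := by exact_mod_cast hL
  have hw := win_entropy hn y Q hQ L (hQ1 L) k hk
  have hlin : ∀ l, -Real.logb 2 (Q l) ≤ C * l.length := neglog_lin Q hQ hnil hmul C hC
  have hgre := greedy_B (fun i K => -Real.logb 2 (Q (win z i K))) C hC0
    (fun i K => by have := hlin (win z i K); simpa using this)
    (fun i a b => by
      have h1 := Real.logb_le_logb_of_le (b := 2) (by norm_num) (mul_pos (hQ _) (hQ _))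
        (hmul (win z i a) (win z (i + a) b))
      rw [Real.logb_mul (hQ _).ne' (hQ _).ne', ← win_add] at h1
      linarith) e he s M hM hs hb
  let e' : ℕ → ℝ := fun p => if p < n then e p else 0
  have he' : ∀ p, 0 ≤ e' p := fun p => by simp only [e']; split_ifs <;> simp [he]
  have hCM : 0 ≤ 2 * M * C := by positivity
  have hpt : ∀ i ∈ Finset.range n, -Real.logb 2 (Q (win (cyc hn y) i L)) ≤
      2 * M * C + ∑ t ∈ Finset.range L, e' (i + t) + (if n < i + L then C * L else 0) := by
    intro i hi
    have hs0 : 0 ≤ ∑ t ∈ Finset.range L, e' (i + t) := Finset.sum_nonneg fun t _ => he' _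
    by_cases h : n < i + L
    · rw [if_pos h]
      have := hlin (win (cyc hn y) i L)
      rw [win_length] at this
      linarith
    · rw [if_neg h]
      have e1 : win (cyc hn y) i L = win z i L := win_congr fun j hj => by
        have := cyc_lt hn y ⟨i + j, by omega⟩
        simpa [hy] using this
      rw [e1]
      have e2 : ∑ t ∈ Finset.range L, e' (i + t) = ∑ t ∈ Finset.range L, e (i + t) :=
        Finset.sum_congr rfl fun t ht => by
          have := Finset.mem_range.1 ht
          simp only [e']; rw [if_pos (by omega)]
      rw [e2]
      have := hgre i L
      linarith
  have hsum1 : ∀ t, ∑ i ∈ Finset.range n, e' (i + t) ≤ ∑ p ∈ Finset.range n, e p := by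
    intro t
    have h1 : ∑ p ∈ Finset.range (t + n), e' p = ∑ p ∈ Finset.range t, e' p + ∑ i ∈ Finset.range n, e' (t + i) :=
      Finset.sum_range_add _ _ _
    have h2 : ∑ p ∈ Finset.range (n + t), e' p = ∑ p ∈ Finset.range n, e' p + ∑ i ∈ Finset.range t, e' (n + i) :=
      Finset.sum_range_add _ _ _
    have h3 : ∑ i ∈ Finset.range t, e' (n + i) = 0 := Finset.sum_eq_zero fun i _ => by
      simp only [e']; rw [if_neg (by omega)]
    have h4 : ∑ p ∈ Finset.range n, e' p = ∑ p ∈ Finset.range n, e p := Finset.sum_congr rfl fun p hp => by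
      simp only [e']; rw [if_pos (Finset.mem_range.1 hp)]
    have h5 : 0 ≤ ∑ p ∈ Finset.range t, e' p := Finset.sum_nonneg fun t _ => he' _
    rw [add_comm t n] at h1
    have h6 : ∑ i ∈ Finset.range n, e' (t + i) = ∑ i ∈ Finset.range n, e' (i + t) :=
      Finset.sum_congr rfl fun i _ => by rw [add_comm]
    linarith
  have hsum2 : ∑ i ∈ Finset.range n, (if n < i + L then C * L else 0) ≤ L * (C * L) := by
    rw [Finset.sum_ite, Finset.sum_const_zero, add_zero, Finset.sum_const, nsmul_eq_mul]
    refine mul_le_mul_of_nonneg_right ?_ (by positivity)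
    have h1 : Finset.filter (fun i => n < i + L) (Finset.range n) ⊆ Finset.Ico (n - L) n := by
      intro i hi
      simp at hi ⊢
      omega
    have h2 := Finset.card_le_card h1
    rw [Nat.card_Ico] at h2
    have h3 : (Finset.filter (fun i => n < i + L) (Finset.range n)).card ≤ L := by omega
    exact_mod_cast h3
  have htot : ∑ i ∈ Finset.range n, -Real.logb 2 (Q (win (cyc hn y) i L)) ≤
      n * (2 * M * C) + L * ∑ p ∈ Finset.range n, e p + L * (C * L) := by
    refine (Finset.sum_le_sum hpt).trans ?_
    rw [Finset.sum_add_distrib, Finset.sum_add_distrib, Finset.sum_const, Finset.card_range, nsmul_eq_mul]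
    rw [Finset.sum_comm]
    have : ∑ t ∈ Finset.range L, ∑ i ∈ Finset.range n, e' (i + t) ≤ L * ∑ p ∈ Finset.range n, e p := by
      refine (Finset.sum_le_sum fun t _ => hsum1 t).trans ?_
      simp
    linarith
  have hfin : L * (n * condEmpEntropy n k y) ≤ L * (2 * M * C * n / L + C * L + ∑ p ∈ Finset.range n, e p) := by
    refine (hw.trans htot).trans (le_of_eq ?_)
    field_simp
    ring
  exact le_of_mul_le_mul_left hfin hL0

theorem det_bound (d : X → A → ℝ) (α : ℝ) (hα : 0 < α) (hd : ∀ a b, 0 ≤ d a b)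
    (C2 : ℝ) (hC20 : 0 ≤ C2) (hC2 : ∀ a b, α * d a b ≤ C2)
    {M K : ℕ} (hM : 1 ≤ M) (hK : 1 ≤ K) (Y : Fin K → Fin M → A) :
    ∃ C : ℝ, 0 ≤ C ∧ ∀ (x : ℕ → X) (n L k : ℕ), 0 < n → 1 ≤ L → L ≤ k + 1 → ∃ y : Fin n → A,
      n * (condEmpEntropy n k y + α * avgDist d n (fun i : Fin n => x i.val) y) ≤
        2 * M * C * n / L + C * L + 2 * M * C2 + (∑ p ∈ Finset.range n,
          ((⨅ j : Fin K, (Real.logb 2 (j + 1) + dl d α (shift^[p] x) (List.ofFn (Y j)))) +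
            (Real.logb 2 (1 + Real.log K) + 1))) / M := by
  obtain ⟨Q, hQ, hnil, hmul, hQ1, hQY⟩ := Q_exists hM hK Y
  obtain ⟨C1, hC1⟩ := (Set.finite_range (fun a => -Real.logb 2 (Q [a]))).bddAbove
  have hC : ∀ a, -Real.logb 2 (Q [a]) ≤ max C1 0 := fun a => (hC1 ⟨a, rfl⟩).trans (le_max_left _ _)
  refine ⟨max C1 0, le_max_right _ _, ?_⟩
  set C := max C1 0
  have hC0 : 0 ≤ C := le_max_right _ _
  intro x n L k hn hL hk
  have hKne : Nonempty (Fin K) := ⟨⟨0, hK⟩⟩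
  have hM0 : (0:ℝ) < M := by exact_mod_cast hM
  choose φ hφ using fun x : ℕ → X => exists_eq_ciInf_of_finite
    (f := fun j : Fin K => (Real.logb 2 (j + 1) + dl d α x (List.ofFn (Y j))))
  let κ := Real.logb 2 (1 + Real.log K) + 1
  let f : ℕ → ℝ := fun p => (⨅ j : Fin K, (Real.logb 2 (j + 1) + dl d α (shift^[p] x) (List.ofFn (Y j)))) + κ
  have hle1 : ∀ l, Q l ≤ 1 := fun l => (le_sumL (fun l _ => (hQ l).le) rfl).trans (hQ1 l.length)
  have hnl : ∀ l, 0 ≤ -Real.logb 2 (Q l) := fun l => by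
    have := Real.logb_nonpos (b := 2) (by norm_num) (hQ l).le (hle1 l)
    linarith
  -- choose the phase
  have hphase : ∃ s ∈ Finset.range M, ∑ p ∈ Finset.range n, (if p % M = s then f p else 0) ≤
      (∑ p ∈ Finset.range n, f p) / M := by
    apply Finset.exists_le_of_sum_le ⟨0, Finset.mem_range.2 hM⟩
    rw [Finset.sum_comm, Finset.sum_const, Finset.card_range, nsmul_eq_mul, mul_div_cancel₀ _ hM0.ne']
    refine Finset.sum_le_sum fun p _ => ?_
    rw [Finset.sum_ite_eq, if_pos (Finset.mem_range.2 (Nat.mod_lt _ hM))]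
  obtain ⟨s, hs, hsum⟩ := hphase
  have hs := Finset.mem_range.1 hs
  let a0 : A := Classical.arbitrary A
  let z : ℕ → A := fun p => if p < s then a0 else
    Y (φ (shift^[s + (p - s) / M * M] x)) ⟨(p - s) % M, Nat.mod_lt _ hM⟩
  have hz : ∀ b, win z (s + b * M) M = List.ofFn (Y (φ (shift^[s + b * M] x))) := by
    intro b
    unfold win
    congr 1
    funext j
    simp only [z]
    have h1 : s + b * M + (j:ℕ) - s = j + b * M := by omega
    have h2 : (j + b * M) / M = b := by
      rw [Nat.add_mul_div_right _ _ hM, Nat.div_eq_of_lt j.2, zero_add]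
    have h3 : (j + b * M) % M = j := by
      rw [Nat.add_mul_mod_self_right, Nat.mod_eq_of_lt j.2]
    rw [if_neg (by omega)]
    simp only [h1, h2, h3]
  let e1 : ℕ → ℝ := fun p => if p % M = s then -Real.logb 2 (Q (List.ofFn (Y (φ (shift^[p] x))))) else 0
  let e2 : ℕ → ℝ := fun p => if p % M = s then dl d α (shift^[p] x) (List.ofFn (Y (φ (shift^[p] x)))) else 0
  have hmod : ∀ b, (s + b * M) % M = s := fun b => by
    rw [Nat.add_mul_mod_self_right, Nat.mod_eq_of_lt hs]
  have h1 := ent_block hn z Q hQ hnil hmul hQ1 C hC0 hC e1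
    (fun p => by simp only [e1]; split_ifs <;> simp only [le_refl, hnl]) s M hM hs
    (fun b => by rw [hz]; simp only [e1]; rw [if_pos (hmod b)]) L k hL hk
  have h2 := greedy_B (fun i K => dl d α (shift^[i] x) (win z i K)) C2 hC20
    (fun i K => by have := dl_le d α C2 hC2 (shift^[i] x) (win z i K); simpa using this)
    (fun i a b => by
      rw [win_add, dl_append, win_length, ← Function.iterate_add_apply, add_comm a i]) e2
    (fun p => by simp only [e2]; split_ifs <;> simp only [le_refl, dl_nonneg d α hα.le hd]) s M hM hs
    (fun b => by rw [hz]; simp only [e2]; rw [if_pos (hmod b)]) 0 n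
  refine ⟨fun i => z i, ?_⟩
  have h3 : dl d α x (win z 0 n) = n * (α * avgDist d n (fun i : Fin n => x i.val) (fun i : Fin n => z i)) := by
    rw [← dl_avg d α hn]
    congr 1
    unfold win
    simp
  simp only [Function.iterate_zero, id, zero_add] at h2
  rw [h3] at h2
  have h4 : ∑ p ∈ Finset.range n, e1 p + ∑ p ∈ Finset.range n, e2 p ≤
      ∑ p ∈ Finset.range n, (if p % M = s then f p else 0) := by
    rw [← Finset.sum_add_distrib]
    refine Finset.sum_le_sum fun p _ => ?_
    simp only [e1, e2, f]
    split_ifs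
    · rw [← hφ]
      have := hQY (φ (shift^[p] x))
      simp only [κ]
      linarith
    · simp
  rw [mul_add]
  have h5 : (∑ p ∈ Finset.range n, f p) / M = (∑ p ∈ Finset.range n,
          ((⨅ j : Fin K, (Real.logb 2 (j + 1) + dl d α (shift^[p] x) (List.ofFn (Y j)))) +
            (Real.logb 2 (1 + Real.log K) + 1))) / M := rfl
  rw [← h5]
  linarith
end det

section fin
variable {X A : Type*} [Fintype X] [DecidableEq X] [MeasurableSpace X] [DiscreteMeasurableSpace X]
    [Fintype A] [DecidableEq A] [Nonempty A]

theorem achiev (μ : Measure (ℕ → X)) [IsProbabilityMeasure μ] (hT : Ergodic (shift : (ℕ → X) → ℕ → X) μ)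
    (d : X → A → ℝ) (α : ℝ) (hα : 0 < α) (hd : ∀ a b, 0 ≤ d a b)
    (kn : ℕ → ℕ) (hkn1 : Tendsto kn atTop atTop) (c : ℝ)
    (hc : (⨅ (D : ℝ) (_ : 0 ≤ D), RDfun (Xh := A) μ d D + ((α * D : ℝ) : EReal)) < (c : EReal)) :
    ∀ᵐ x ∂μ, ∀ᶠ n : ℕ in atTop,
      (⨅ y : Fin n → A, (condEmpEntropy n (kn n) y + α * avgDist d n (fun i : Fin n => x i.val) y)) ≤ c := by
  obtain ⟨C', hC'⟩ := (Set.finite_range (fun p : X × A => α * d p.1 p.2)).bddAbove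
  have hC2 : ∀ a b, α * d a b ≤ max C' 0 := fun a b => (hC' ⟨(a, b), rfl⟩).trans (le_max_left _ _)
  have hC20 : 0 ≤ max C' 0 := le_max_right _ _
  set C2 := max C' 0
  obtain ⟨M, K, hM, hK, Y, hY⟩ := code_exists μ hT d α hα hd C2 hC20 hC2 c hc
  obtain ⟨C, hC0, hdet⟩ := det_bound d α hα hd C2 hC20 hC2 hM hK Y
  have hM0 : (0:ℝ) < M := by exact_mod_cast hM
  set κ := Real.logb 2 (1 + Real.log K) + 1 with hκ
  have hκ0 : 0 ≤ κ := by
    have h1 : (1:ℝ) ≤ K := by exact_mod_cast hK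
    have h2 := Real.log_nonneg h1
    have h3 := Real.logb_nonneg (b := 2) (by norm_num) (show (1:ℝ) ≤ 1 + Real.log K by linarith)
    rw [hκ]; linarith
  let f : (ℕ → X) → ℝ := fun x => (⨅ j : Fin K, (Real.logb 2 (j + 1) + dl d α x (List.ofFn (Y j)))) + κ
  have hcm := cost_meas (fun (x : ℕ → X) (v : Fin M → A) => dl d α x (List.ofFn v))
    (fun v => dl_measurable d α _) Y
  have hcb := fun x : ℕ → X => cost_bd (fun v : Fin M → A => dl d α x (List.ofFn v)) (C2 * M)
    (fun v => dl_nonneg d α hα.le hd x _) (fun v => by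
        have := dl_le d α C2 hC2 x (List.ofFn v)
        simpa using this) hK Y
  have hIntg : ∫ x, f x ∂μ < M * c := by
    have : ∫ x, f x ∂μ = ∫ x, (⨅ j : Fin K, (Real.logb 2 (j + 1) + dl d α x (List.ofFn (Y j)))) ∂μ + κ := by
      simp only [f]
      rw [integral_add _ (integrable_const _)]
      · simp
      · refine Integrable.of_bound hcm.aestronglyMeasurable (C2 * M) (Eventually.of_forall fun x => ?_)
        rw [Real.norm_of_nonneg (hcb x).1]; exact (hcb x).2
    rw [this, hκ]; linarith
  have hIntg' : (∫ x, f x ∂μ) / M < c := by rw [div_lt_iff₀ hM0]; linarith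
  obtain ⟨c', hc1, hc2⟩ := exists_between hIntg'
  rw [div_lt_iff₀ hM0] at hc1
  have hbk := birkhoff_upper hT f (hcm.add_const κ) (C2 * M + κ)
    (fun x => by have := (hcb x).1; simp only [f]; linarith)
    (fun x => by have := (hcb x).2; simp only [f]; linarith) (c' * M) hc1
  obtain ⟨L, hL⟩ := exists_nat_gt (2 * M * C * (2 / (c - c')))
  have hL0 : (0:ℝ) < L := lt_of_le_of_lt (by have := sub_pos.2 hc2; positivity) hL
  have hL1 : 1 ≤ L := by exact_mod_cast hL0
  obtain ⟨n0, hn0⟩ := exists_nat_gt ((C * L + 2 * M * C2) * (2 / (c - c')))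
  have hcc := sub_pos.2 hc2
  filter_upwards [hbk] with x hx
  filter_upwards [hx, hkn1.eventually_ge_atTop L, eventually_ge_atTop n0, eventually_ge_atTop 1] with n h1 h2 h3 h4
  obtain ⟨y, hy⟩ := hdet x n L (kn n) h4 hL1 (by omega)
  refine (ciInf_le (Set.finite_range _).bddBelow y).trans ?_
  have hn : (0:ℝ) < n := by exact_mod_cast h4
  have h5 : (∑ p ∈ Finset.range n, f (shift^[p] x)) / M ≤ n * c' := by
    rw [div_le_iff₀ hM0]; linarith
  have h6 : (C * L + 2 * M * C2) ≤ n * ((c - c') / 2) := by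
    have : (n0:ℝ) ≤ n := by exact_mod_cast h3
    have h7 := hn0.le.trans this
    rw [mul_div_assoc', div_le_iff₀ hcc] at h7
    linarith
  have h8 : 2 * M * C * n / L ≤ n * ((c - c') / 2) := by
    rw [div_le_iff₀ hL0]
    have h7 := hL.le
    rw [mul_div_assoc', div_le_iff₀ hcc] at h7
    nlinarith
  have h9 : n * (condEmpEntropy n (kn n) y + α * avgDist d n (fun i : Fin n => x i.val) y) ≤ n * c := by
    have : (∑ p ∈ Finset.range n, f (shift^[p] x)) / M = (∑ p ∈ Finset.range n,
          ((⨅ j : Fin K, (Real.logb 2 (j + 1) + dl d α (shift^[p] x) (List.ofFn (Y j)))) + κ)) / M := rfl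
    rw [this] at h5
    nlinarith
  exact le_of_mul_le_mul_left h9 hn

theorem main (μ : Measure (ℕ → X)) [IsProbabilityMeasure μ] (hT : Ergodic (shift : (ℕ → X) → ℕ → X) μ)
    (d : X → A → ℝ) (hd : ∀ a b, 0 ≤ d a b) (α : ℝ) (hα : 0 < α)
    (kn : ℕ → ℕ) (hkn1 : Tendsto kn atTop atTop)
    (hkn2 : Tendsto (fun n => (kn n : ℝ) / Real.log n) atTop (nhds 0)) :
    ∀ᵐ x ∂μ, Tendsto
      (fun n : ℕ =>
        ((⨅ y : Fin n → A,
            (condEmpEntropy n (kn n) y +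
              α * avgDist d n (fun i : Fin n => x i.val) y) : ℝ) : EReal))
      atTop
      (nhds (⨅ (D : ℝ) (_ : 0 ≤ D), RDfun (Xh := A) μ d D + ((α * D : ℝ) : EReal))) := by
  set V : EReal := ⨅ (D : ℝ) (_ : 0 ≤ D), RDfun (Xh := A) μ d D + ((α * D : ℝ) : EReal) with hV
  have hlow : ∀ᵐ x ∂μ, ∀ c : ℚ, ((c:ℝ) : EReal) < V → ∀ᶠ n : ℕ in atTop, (c:ℝ) ≤
      ⨅ y : Fin n → A, (condEmpEntropy n (kn n) y + α * avgDist d n (fun i : Fin n => x i.val) y) := by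
    rw [ae_all_iff]
    intro c
    by_cases h : ((c:ℝ) : EReal) < V
    · obtain ⟨r, hr1, hr2⟩ := EReal.lt_iff_exists_real_btwn.1 h
      filter_upwards [converse μ hT d α hα hd kn hkn2 r hr2.le c (EReal.coe_lt_coe_iff.1 hr1)] with x hx _
      exact hx
    · exact Eventually.of_forall fun x hx => absurd hx h
  have hup : ∀ᵐ x ∂μ, ∀ c : ℚ, V < ((c:ℝ) : EReal) → ∀ᶠ n : ℕ in atTop,
      (⨅ y : Fin n → A, (condEmpEntropy n (kn n) y + α * avgDist d n (fun i : Fin n => x i.val) y)) ≤ (c:ℝ) := by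
    rw [ae_all_iff]
    intro c
    by_cases h : V < ((c:ℝ) : EReal)
    · filter_upwards [achiev μ hT d α hα hd kn hkn1 c h] with x hx _
      exact hx
    · exact Eventually.of_forall fun x hx => absurd hx h
  filter_upwards [hlow, hup] with x hl hu
  rw [tendsto_order]
  constructor
  · intro a ha
    obtain ⟨c, h1, h2⟩ := EReal.lt_iff_exists_rat_btwn.1 ha
    filter_upwards [hl c h2] with n hn
    exact h1.trans_le (EReal.coe_le_coe_iff.2 hn)
  · intro a ha
    obtain ⟨c, h1, h2⟩ := EReal.lt_iff_exists_rat_btwn.1 ha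
    filter_upwards [hu c h1] with n hn
    exact (EReal.coe_le_coe_iff.2 hn).trans_lt h2
end fin
end EFS

/-- Universality of exhaustive-search fixed-slope lossy coding: for a stationary
ergodic source, slope `α > 0`, and context orders `k_n → ∞` with
`k_n/log n → 0` and `k_n < n`, the minimal value over reconstruction blocks of
`H_{k_n}(y) + α d_n(xⁿ, y)` converges almost surely to
`inf_{D ≥ 0} [R(D) + αD]`. -/
theorem exhaustive_fixed_slope_universal {X Xh : Type*} [Fintype X] [DecidableEq X]
    [MeasurableSpace X] [DiscreteMeasurableSpace X]
    [Fintype Xh] [DecidableEq Xh] [Nonempty Xh]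
    (μ : Measure (ℕ → X)) [IsProbabilityMeasure μ]
    (herg : Ergodic (fun x : ℕ → X => fun i => x (i + 1)) μ)
    (d : X → Xh → ℝ) (hd : ∀ a b, 0 ≤ d a b)
    (α : ℝ) (hα : 0 < α)
    (kn : ℕ → ℕ) (hkn1 : Tendsto kn atTop atTop)
    (hkn2 : Tendsto (fun n => (kn n : ℝ) / Real.log n) atTop (nhds 0))
    (hkn3 : ∀ n, 1 ≤ n → kn n < n) :
    ∀ᵐ x ∂μ, Tendsto
      (fun n : ℕ =>
        ((⨅ y : Fin n → Xh,
            (condEmpEntropy n (kn n) y +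
              α * avgDist d n (fun i : Fin n => x i.val) y) : ℝ) : EReal))
      atTop
      (nhds (⨅ (D : ℝ) (_ : 0 ≤ D), RDfun (Xh := Xh) μ d D + ((α * D : ℝ) : EReal))) := by
  exact EFS.main μ herg d hd α hα kn hkn1 hkn2
end
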